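/- arXiv:2303.11582 — 8 statements merged into one kernel-verified Lean document; each statement's English description precedes it below -/
import Mathlib

section
/- Let h and ε be independent real random variables with h ~ N(μ, σ²) and ε ~ N(0,1), and define the observation G = π h + sqrt(π s² / b) · ε. Define the updated posterior variance σ'² = (σ⁻² + s⁻² b π)⁻¹ and the updated posterior mean μ' = σ'² (σ⁻² μ + s⁻² b G). Then (i) σ² − σ'² = σ⁴ b π / (s² + σ² b π), and (ii) the law of the random variable μ' is the Gaussian distribution N(μ, σ² − σ'²). -/
open MeasureTheory ProbabilityTheory

/-- An affine combination of two independent Gaussian random variables is Gaussian. -/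
theorem hasLaw_gaussianReal_affine_of_indepFun {Ω : Type*} [MeasurableSpace Ω] {P : Measure Ω}
    {X Y : Ω → ℝ} {m₁ m₂ : ℝ} {v₁ v₂ : NNReal} (hXY : IndepFun X Y P)
    (hX : HasLaw X (gaussianReal m₁ v₁) P) (hY : HasLaw Y (gaussianReal m₂ v₂) P) (a c d : ℝ) :
    HasLaw (fun ω => d + (a * X ω + c * Y ω))
      (gaussianReal (a * m₁ + c * m₂ + d)
        (.mk (a ^ 2) (sq_nonneg _) * v₁ + .mk (c ^ 2) (sq_nonneg _) * v₂)) P := by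
  have hX' := gaussianReal_const_mul hX a
  have hY' := gaussianReal_const_mul hY c
  have hind : IndepFun (fun ω => a * X ω) (fun ω => c * Y ω) P :=
    hXY.comp (measurable_const_mul a) (measurable_const_mul c)
  exact gaussianReal_const_add ⟨hX'.aemeasurable.add hY'.aemeasurable,
    gaussianReal_add_gaussianReal_of_indepFun hind hX'.map_eq hY'.map_eq⟩ d

/-- One-arm posterior-update reparameterization for the Gaussian
sequential experiment: prior `h ~ N(μ, σ²)`, noise `ε ~ N(0,1)` independent of `h`,
observation `G = π h + sqrt(π s² / b) ε`. With updated posterior variance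
`σ'² = (σ⁻² + s⁻² b π)⁻¹` and posterior mean `μ' = σ'² (σ⁻² μ + s⁻² b G)`, we have
(i) `σ² − σ'² = σ⁴ b π / (s² + σ² b π)` and (ii) `μ' ~ N(μ, σ² − σ'²)`. -/
theorem stmt0
    (μ σ s b π : ℝ) (hσ : 0 < σ) (hs : 0 < s) (hb : 0 < b)
    (hπ0 : 0 < π) (hπ1 : π ≤ 1)
    {Ω : Type*} [MeasurableSpace Ω] (P : Measure Ω) [IsProbabilityMeasure P]
    (h ε : Ω → ℝ)
    (hind : IndepFun h ε P)
    (hlaw : P.map h = gaussianReal μ (Real.toNNReal (σ ^ 2)))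
    (hεlaw : P.map ε = gaussianReal 0 1)
    (G : Ω → ℝ) (hG : G = fun ω => π * h ω + Real.sqrt (π * s ^ 2 / b) * ε ω)
    (v' : ℝ) (hv' : v' = ((σ ^ 2)⁻¹ + (s ^ 2)⁻¹ * b * π)⁻¹)
    (μ' : Ω → ℝ) (hμ' : μ' = fun ω => v' * ((σ ^ 2)⁻¹ * μ + (s ^ 2)⁻¹ * b * G ω)) :
    σ ^ 2 - v' = σ ^ 4 * b * π / (s ^ 2 + σ ^ 2 * b * π) ∧
      P.map μ' = gaussianReal μ (Real.toNNReal (σ ^ 2 - v')) := by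
  have hden : 0 < s ^ 2 + σ ^ 2 * b * π := by positivity
  have hv : v' = σ ^ 2 * s ^ 2 / (s ^ 2 + σ ^ 2 * b * π) := by
    rw [hv']
    field_simp
  have hdiff : σ ^ 2 - v' = σ ^ 4 * b * π / (s ^ 2 + σ ^ 2 * b * π) := by
    rw [hv]
    field_simp
    ring
  refine ⟨hdiff, ?_⟩
  have hh : HasLaw h (gaussianReal μ (Real.toNNReal (σ ^ 2))) P :=
    ⟨aemeasurable_of_map_neZero (by rw [hlaw]; infer_instance), hlaw⟩
  have hε : HasLaw ε (gaussianReal 0 1) P :=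
    ⟨aemeasurable_of_map_neZero (by rw [hεlaw]; infer_instance), hεlaw⟩
  have hμ'_eq : μ' = fun ω => v' * (σ ^ 2)⁻¹ * μ + (v' * (s ^ 2)⁻¹ * b * π * h ω +
      v' * (s ^ 2)⁻¹ * b * Real.sqrt (π * s ^ 2 / b) * ε ω) := by
    rw [hμ', hG]
    ext ω
    ring
  rw [hμ'_eq, (hasLaw_gaussianReal_affine_of_indepFun hind hh hε _ _ _).map_eq]
  congr 1
  · rw [hv]
    field_simp
    ring
  · have hnonneg : 0 ≤ σ ^ 2 - v' := by
      rw [hdiff]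
      positivity
    apply NNReal.eq
    rw [Real.coe_toNNReal _ hnonneg, hdiff]
    simp only [NNReal.coe_add, NNReal.coe_mul, NNReal.coe_mk, mul_one,
      Real.coe_toNNReal _ (sq_nonneg σ)]
    rw [mul_pow _ (Real.sqrt _), Real.sq_sqrt (by positivity), hv]
    field_simp
    ring
end

section
/- Define σ_{t} = σ and, recursively for v = t, …, T−1, σ_{v+1,a}² = (σ_{v,a}⁻² + s_a⁻² b_v ρ_{v,a})⁻¹ for each arm a. Let b̄ = Σ_{v=t}^{T−1} b_v and ρ̄_a = (Σ_{v=t}^{T−1} b_v ρ_{v,a}) / b̄. Then (i) ρ̄ ∈ Δ_K; (ii) for every arm a, σ_{t,a}² − σ_{T,a}² = σ_{t,a}⁴ ρ̄_a b̄ / (s_a² + σ_{t,a}² ρ̄_a b̄); and consequently (iii) E[max_a { μ_a + sqrt(σ_{t,a}² − σ_{T,a}²) · Z_a }] = E[max_a { μ_a + sqrt(σ_{t,a}⁴ ρ̄_a b̄ / (s_a² + σ_{t,a}² ρ̄_a b̄)) · Z_a }], i.e., any deterministic sequence of allocations achieves the same terminal value as the single constant allocation ρ̄. -/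
open MeasureTheory ProbabilityTheory

/-- If inverses accumulate increments `c v` from `t` on, then the inverse at `n` is the initial
inverse plus the sum of all increments. -/
theorem inv_eq_inv_add_sum_Ico {F : Type*} [Field F] {x c : ℕ → F} {t T : ℕ} (htT : t ≤ T)
    (hx : ∀ v, t ≤ v → v < T → x (v + 1) = ((x v)⁻¹ + c v)⁻¹) :
    (x T)⁻¹ = (x t)⁻¹ + ∑ v ∈ Finset.Ico t T, c v := by
  induction T, htT using Nat.le_induction with
  | base => simp
  | succ n hn ih =>
    rw [Finset.sum_Ico_succ_top hn, hx n hn n.lt_succ_self, inv_inv,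
      ih fun v hv hvn => hx v hv (hvn.trans n.lt_succ_self), add_assoc]

/-- The variance reduction of a Gaussian posterior whose precision grows by `d / q`. -/
theorem sub_eq_of_inv_eq_inv_add_div {p q d y : ℝ} (hp : 0 < p) (hq : 0 < q) (hd : 0 ≤ d)
    (hy : y⁻¹ = p⁻¹ + q⁻¹ * d) : p - y = p ^ 2 * d / (q + p * d) := by
  have hne : q + p * d ≠ 0 := by positivity
  have hy' : y = p * q / (q + p * d) := by
    rw [← inv_inv y, hy, inv_eq_iff_eq_inv, inv_div]
    field_simp
  rw [hy']
  field_simp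
  ring

/-- Any deterministic sequence of allocations `ρ_t, …, ρ_{T−1}` in the
simplex achieves the same terminal value as the single constant allocation
`ρ̄_a = (Σ_v b_v ρ_{v,a}) / b̄`, where the posterior variances evolve as
`σ_{v+1,a}² = (σ_{v,a}⁻² + s_a⁻² b_v ρ_{v,a})⁻¹`. -/
theorem stmt1
    (K : ℕ) (hK : 0 < K) (t T : ℕ) (htT : t < T)
    (b : ℕ → ℝ) (hb : ∀ v, t ≤ v → v < T → 0 < b v)
    (s : Fin K → ℝ) (hs : ∀ a, 0 < s a)
    (μ : Fin K → ℝ) (σ : Fin K → ℝ) (hσ : ∀ a, 0 < σ a)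
    (ρ : ℕ → Fin K → ℝ)
    (hρ : ∀ v, t ≤ v → v < T → (∀ a, 0 ≤ ρ v a) ∧ ∑ a, ρ v a = 1)
    (σsq : ℕ → Fin K → ℝ)
    (hinit : ∀ a, σsq t a = (σ a) ^ 2)
    (hrec : ∀ v, t ≤ v → v < T → ∀ a,
      σsq (v + 1) a = ((σsq v a)⁻¹ + ((s a) ^ 2)⁻¹ * b v * ρ v a)⁻¹)
    (bbar : ℝ) (hbbar : bbar = ∑ v ∈ Finset.Ico t T, b v)
    (ρbar : Fin K → ℝ)
    (hρbar : ∀ a, ρbar a = (∑ v ∈ Finset.Ico t T, b v * ρ v a) / bbar) :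
    ((∀ a, 0 ≤ ρbar a) ∧ ∑ a, ρbar a = 1) ∧
    (∀ a, σsq t a - σsq T a
        = (σsq t a) ^ 2 * ρbar a * bbar / ((s a) ^ 2 + σsq t a * ρbar a * bbar)) ∧
    (∫ z : Fin K → ℝ, (⨆ a, (μ a + Real.sqrt (σsq t a - σsq T a) * z a))
        ∂(Measure.pi fun _ => gaussianReal 0 1))
      = ∫ z : Fin K → ℝ,
          (⨆ a, (μ a + Real.sqrt ((σsq t a) ^ 2 * ρbar a * bbar
              / ((s a) ^ 2 + σsq t a * ρbar a * bbar)) * z a))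
          ∂(Measure.pi fun _ => gaussianReal 0 1) := by
  have hbpos : 0 < bbar := by
    rw [hbbar]
    refine Finset.sum_pos (fun v hv => ?_) (Finset.nonempty_Ico.2 htT)
    exact hb v (Finset.mem_Ico.1 hv).1 (Finset.mem_Ico.1 hv).2
  have hnonneg : ∀ a, 0 ≤ ρbar a := fun a => by
    rw [hρbar]
    refine div_nonneg (Finset.sum_nonneg fun v hv => ?_) hbpos.le
    obtain ⟨h₁, h₂⟩ := Finset.mem_Ico.1 hv
    exact mul_nonneg (hb v h₁ h₂).le ((hρ v h₁ h₂).1 a)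
  have hsum : ∑ a, ρbar a = 1 := by
    simp_rw [hρbar]
    rw [← Finset.sum_div, Finset.sum_comm, div_eq_one_iff_eq hbpos.ne', hbbar]
    refine Finset.sum_congr rfl fun v hv => ?_
    obtain ⟨h₁, h₂⟩ := Finset.mem_Ico.1 hv
    rw [← Finset.mul_sum, (hρ v h₁ h₂).2, mul_one]
  have hvar : ∀ a, σsq t a - σsq T a
      = (σsq t a) ^ 2 * ρbar a * bbar / ((s a) ^ 2 + σsq t a * ρbar a * bbar) := fun a => by
    have hpos : 0 < σsq t a := by
      rw [hinit]
      exact pow_pos (hσ a) 2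
    have htotal : ρbar a * bbar = ∑ v ∈ Finset.Ico t T, b v * ρ v a := by
      rw [hρbar, div_mul_cancel₀ _ hbpos.ne']
    have hinv := inv_eq_inv_add_sum_Ico (x := fun v => σsq v a) htT.le
      fun v h₁ h₂ => hrec v h₁ h₂ a
    simp_rw [mul_assoc, ← Finset.mul_sum, ← htotal] at hinv
    simpa only [mul_assoc] using sub_eq_of_inv_eq_inv_add_div hpos (pow_pos (hs a) 2)
      (mul_nonneg (hnonneg a) hbpos.le) hinv
  refine ⟨⟨hnonneg, hsum⟩, hvar, ?_⟩
  simp_rw [hvar]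
end

section
/- Define the constant-allocation value V(ρ̄; μ, σ, B) = E[max_a { μ_a + sqrt(σ_a⁴ ρ̄_a B / (s_a² + σ_a² ρ̄_a B)) · Z_a }] for ρ̄ ∈ Δ_K and B > 0. Let b̄_t = Σ_{v=t}^{T−1} b_v. Suppose for each t ∈ {0, …, T−1} there is a measurable map ρ_t : ℝ^K × (0,∞)^K → Δ_K such that ρ_t(μ, σ) ∈ argmax_{ρ̄ ∈ Δ_K} V(ρ̄; μ, σ, b̄_t) for every (μ, σ). Define the Residual Horizon Optimization value functions backwards by W_T(μ, σ) = max_a μ_a and W_t(μ, σ) = E[W_{t+1}(μ', σ')], where σ'_a² = (σ_a⁻² + s_a⁻² b_t ρ_{t,a}(μ, σ))⁻¹ and μ'_a = μ_a + sqrt(σ_a² − σ'_a²) · Z_a with Z_1, …, Z_K i.i.d. standard normal. Then for every t ∈ {0, …, T−1}, every μ ∈ ℝ^K and σ ∈ (0,∞)^K, and every ρ̄ ∈ Δ_K, one has W_t(μ, σ) ≥ V(ρ̄; μ, σ, b̄_t). In particular, W_t(μ, σ) is at least the value of the uniform allocation ρ̄_a ≡ 1/K. -/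
open MeasureTheory ProbabilityTheory

/-- Product of `K` independent standard Gaussians on `Fin K → ℝ`. -/
noncomputable def gaussPi (K : ℕ) : Measure (Fin K → ℝ) :=
  Measure.pi fun _ => gaussianReal 0 1

/-- The probability simplex `Δ_K`. -/
def simplex (K : ℕ) : Set (Fin K → ℝ) :=
  {ρ | (∀ a, 0 ≤ ρ a) ∧ ∑ a, ρ a = 1}

/-- Constant-allocation value
`V(ρ̄; μ, σ, B) = E[max_a { μ_a + sqrt(σ_a⁴ ρ̄_a B / (s_a² + σ_a² ρ̄_a B)) Z_a }]`. -/
noncomputable def Vval (K : ℕ) (s : Fin K → ℝ) (ρ : Fin K → ℝ)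
    (μ σ : Fin K → ℝ) (B : ℝ) : ℝ :=
  ∫ z, (⨆ a, (μ a + Real.sqrt ((σ a) ^ 4 * ρ a * B
      / ((s a) ^ 2 + (σ a) ^ 2 * ρ a * B)) * z a)) ∂(gaussPi K)

instance (K : ℕ) : IsProbabilityMeasure (gaussPi K) := by
  unfold gaussPi; infer_instance

theorem abs_ciSup_le_sum_abs {ι : Type*} [Fintype ι] (f : ι → ℝ) :
    |⨆ a, f a| ≤ ∑ a, |f a| := by
  rcases isEmpty_or_nonempty ι with h | h
  · simp
  · obtain ⟨i, hi⟩ := exists_eq_ciSup_of_finite (f := f)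
    rw [← hi]
    exact Finset.single_le_sum (f := fun a => |f a|) (fun _ _ => abs_nonneg _) (Finset.mem_univ i)

theorem integrable_eval_gaussPi {K : ℕ} (a : Fin K) :
    Integrable (fun z : Fin K → ℝ => z a) (gaussPi K) :=
  integrable_comp_eval (μ := fun _ : Fin K => gaussianReal 0 1) (f := id)
    ((memLp_id_gaussianReal 1).integrable (by simp))

theorem map_linear_gaussianReal_prod {α β γ : ℝ} (h : γ ^ 2 = α ^ 2 + β ^ 2) :
    ((gaussianReal 0 1).prod (gaussianReal 0 1)).map (fun p => α * p.1 + β * p.2)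
      = (gaussianReal 0 1).map (fun x => γ * x) := by
  have key : ((gaussianReal 0 1).map (α * ·)) ∗ ((gaussianReal 0 1).map (β * ·))
      = (gaussianReal 0 1).map (γ * ·) := by
    simp only [gaussianReal_map_const_mul, gaussianReal_conv_gaussianReal, mul_zero, add_zero,
      mul_one]
    congr 1
    exact NNReal.eq h.symm
  rw [← key, Measure.conv, Measure.map_prod_map _ _ (by fun_prop) (by fun_prop),
    Measure.map_map (by fun_prop) (by fun_prop)]
  rfl

/-- Independent centred Gaussian vectors add up coordinatewise, with variances adding. -/
theorem map_linear_gaussPi_prod {K : ℕ} {α β γ : Fin K → ℝ}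
    (h : ∀ a, γ a ^ 2 = α a ^ 2 + β a ^ 2) :
    ((gaussPi K).prod (gaussPi K)).map (fun p a => α a * p.1 a + β a * p.2 a)
      = (gaussPi K).map (fun z a => γ a * z a) := by
  have hmp := measurePreserving_arrowProdEquivProdArrow ℝ ℝ (Fin K)
    (fun _ => gaussianReal 0 1) (fun _ => gaussianReal 0 1)
  have hprob (a : Fin K) : IsProbabilityMeasure
      (((gaussianReal 0 1).prod (gaussianReal 0 1)).map (fun p => α a * p.1 + β a * p.2)) :=
    Measure.isProbabilityMeasure_map (by fun_prop)
  unfold gaussPi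
  rw [← hmp.map_eq, Measure.map_map (by fun_prop) (MeasurableEquiv.measurable _),
    Measure.pi_map_pi (f := fun a x => γ a * x) (fun a => by fun_prop)]
  simp only [← map_linear_gaussianReal_prod (h _)]
  exact Measure.pi_map_pi (f := fun a (p : ℝ × ℝ) => α a * p.1 + β a * p.2)
    (fun a => by fun_prop)

theorem integrable_ciSup {Ω : Type*} [MeasurableSpace Ω] {P : Measure Ω} {K : ℕ}
    {f : Fin K → Ω → ℝ} (hf : ∀ a, Integrable (f a) P) (hm : ∀ a, Measurable (f a)) :
    Integrable (fun ω => ⨆ a, f a ω) P := by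
  refine (integrable_finsetSum Finset.univ fun a _ => (hf a).abs).mono'
    (Measurable.iSup hm).aestronglyMeasurable (ae_of_all _ fun ω => ?_)
  exact abs_ciSup_le_sum_abs _

theorem integrable_ciSup_gaussPi_prod {K : ℕ} (μ α β : Fin K → ℝ) :
    Integrable (fun p : (Fin K → ℝ) × (Fin K → ℝ) => ⨆ a, (μ a + α a * p.1 a + β a * p.2 a))
      ((gaussPi K).prod (gaussPi K)) := by
  refine integrable_ciSup (fun a => ?_) (fun a => by fun_prop)
  exact ((integrable_const _).add
    (((integrable_eval_gaussPi a).comp_fst _).const_mul _)).add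
      (((integrable_eval_gaussPi a).comp_snd _).const_mul _)

theorem integral_integral_ciSup_gaussPi {K : ℕ} (μ : Fin K → ℝ) {α β γ : Fin K → ℝ}
    (h : ∀ a, γ a ^ 2 = α a ^ 2 + β a ^ 2) :
    ∫ z, ∫ w, (⨆ a, (μ a + α a * z a + β a * w a)) ∂gaussPi K ∂gaussPi K
      = ∫ z, (⨆ a, (μ a + γ a * z a)) ∂gaussPi K := by
  have hm : Measurable fun x : Fin K → ℝ => ⨆ a, (μ a + x a) :=
    Measurable.iSup fun a => by fun_prop
  rw [← integral_prod _ (integrable_ciSup_gaussPi_prod μ α β)]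
  calc _ = ∫ x, (⨆ a, (μ a + x a))
        ∂((gaussPi K).prod (gaussPi K)).map (fun p a => α a * p.1 a + β a * p.2 a) := by
        rw [integral_map (by fun_prop) hm.aestronglyMeasurable]
        simp only [add_assoc]
    _ = _ := by
        have hγ : Measurable fun (z : Fin K → ℝ) a => γ a * z a := by fun_prop
        rw [map_linear_gaussPi_prod h, integral_map hγ.aemeasurable hm.aestronglyMeasurable]

/-- Posterior variance of one arm with prior standard deviation `σ`, measurement standard
deviation `s` and measurement effort `x`. -/
noncomputable def posteriorVar (s σ x : ℝ) : ℝ := ((σ ^ 2)⁻¹ + (s ^ 2)⁻¹ * x)⁻¹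

/-- Variance of the posterior mean of one arm after measurement effort `x`. -/
noncomputable def varReduction (s σ x : ℝ) : ℝ := σ ^ 4 * x / (s ^ 2 + σ ^ 2 * x)

theorem posteriorVar_pos {s σ x : ℝ} (hσ : 0 < σ) (hx : 0 ≤ x) : 0 < posteriorVar s σ x := by
  unfold posteriorVar; positivity

theorem varReduction_nonneg {s σ x : ℝ} (hx : 0 ≤ x) : 0 ≤ varReduction s σ x := by
  unfold varReduction; positivity

theorem sq_sub_posteriorVar {s σ x : ℝ} (hs : 0 < s) (hσ : 0 < σ) (hx : 0 ≤ x) :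
    σ ^ 2 - posteriorVar s σ x = varReduction s σ x := by
  have : 0 < s ^ 2 + σ ^ 2 * x := by positivity
  have h2 : posteriorVar s σ x = σ ^ 2 * s ^ 2 / (s ^ 2 + σ ^ 2 * x) := by
    unfold posteriorVar
    field_simp
  rw [h2, varReduction]
  field_simp
  ring

theorem posteriorVar_add {s σ x y : ℝ} (hσ : 0 < σ) (hx : 0 ≤ x) :
    posteriorVar s √(posteriorVar s σ x) y = posteriorVar s σ (x + y) := by
  rw [posteriorVar, Real.sq_sqrt (posteriorVar_pos hσ hx).le]
  simp only [posteriorVar, inv_inv]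
  ring

theorem varReduction_add {s σ x y : ℝ} (hs : 0 < s) (hσ : 0 < σ) (hx : 0 ≤ x) (hy : 0 ≤ y) :
    varReduction s σ (x + y)
      = varReduction s σ x + varReduction s √(posteriorVar s σ x) y := by
  have hp := posteriorVar_pos (s := s) hσ hx
  rw [← sq_sub_posteriorVar hs hσ (add_nonneg hx hy), ← sq_sub_posteriorVar hs hσ hx,
    ← sq_sub_posteriorVar hs (Real.sqrt_pos.2 hp) hy, posteriorVar_add hσ hx, Real.sq_sqrt hp.le]
  ring

theorem Vval_eq {K : ℕ} (s ρ μ σ : Fin K → ℝ) (B : ℝ) :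
    Vval K s ρ μ σ B
      = ∫ z, (⨆ a, (μ a + √(varReduction (s a) (σ a) (B * ρ a)) * z a)) ∂gaussPi K := by
  simp only [Vval, varReduction, mul_comm B, mul_assoc]

theorem Vval_zero {K : ℕ} (s ρ μ σ : Fin K → ℝ) : Vval K s ρ μ σ 0 = ⨆ a, μ a := by
  simp [Vval]

/-- Posterior means after measuring with batch size `b` split according to `ρ`. -/
noncomputable def posteriorMean {K : ℕ} (s ρ μ σ : Fin K → ℝ) (b : ℝ) (z : Fin K → ℝ) :
    Fin K → ℝ :=
  fun a => μ a + √(σ a ^ 2 - posteriorVar (s a) (σ a) (b * ρ a)) * z a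

/-- Posterior standard deviations after measuring with batch size `b` split according to `ρ`. -/
noncomputable def posteriorSd {K : ℕ} (s ρ σ : Fin K → ℝ) (b : ℝ) : Fin K → ℝ :=
  fun a => √(posteriorVar (s a) (σ a) (b * ρ a))

section Posterior

variable {K : ℕ} {s ρ μ σ : Fin K → ℝ} {b B : ℝ}

theorem posteriorSd_pos (hσ : ∀ a, 0 < σ a) (hρ : ∀ a, 0 ≤ ρ a) (hb : 0 ≤ b) (a : Fin K) :
    0 < posteriorSd s ρ σ b a :=
  Real.sqrt_pos.2 (posteriorVar_pos (hσ a) (mul_nonneg hb (hρ a)))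

theorem posteriorSd_le (hs : ∀ a, 0 < s a) (hσ : ∀ a, 0 < σ a) (hρ : ∀ a, 0 ≤ ρ a) (hb : 0 ≤ b)
    (a : Fin K) : posteriorSd s ρ σ b a ≤ σ a := by
  refine Real.sqrt_le_iff.2 ⟨(hσ a).le, ?_⟩
  have hx := mul_nonneg hb (hρ a)
  have := sq_sub_posteriorVar (hs a) (hσ a) hx
  linarith [varReduction_nonneg (s := s a) (σ := σ a) hx]

theorem abs_posteriorMean_le (hσ : ∀ a, 0 < σ a) (hρ : ∀ a, 0 ≤ ρ a) (hb : 0 ≤ b)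
    (z : Fin K → ℝ) (a : Fin K) : |posteriorMean s ρ μ σ b z a| ≤ |μ a| + σ a * |z a| := by
  refine (abs_add_le _ _).trans (add_le_add_right ?_ _)
  rw [abs_mul, abs_of_nonneg (Real.sqrt_nonneg _)]
  refine mul_le_mul_of_nonneg_right (Real.sqrt_le_iff.2 ⟨(hσ a).le, ?_⟩) (abs_nonneg _)
  linarith [posteriorVar_pos (s := s a) (hσ a) (mul_nonneg hb (hρ a))]

theorem integrable_Vval_posterior :
    Integrable (fun z => Vval K s ρ (posteriorMean s ρ μ σ b z) (posteriorSd s ρ σ b) B)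
      (gaussPi K) := by
  simp only [Vval_eq]
  exact (integrable_ciSup_gaussPi_prod μ _ _).integral_prod_left

theorem integral_Vval_posterior (hs : ∀ a, 0 < s a) (hσ : ∀ a, 0 < σ a) (hρ : ∀ a, 0 ≤ ρ a)
    (hb : 0 ≤ b) (hB : 0 ≤ B) :
    ∫ z, Vval K s ρ (posteriorMean s ρ μ σ b z) (posteriorSd s ρ σ b) B ∂gaussPi K
      = Vval K s ρ μ σ (b + B) := by
  simp only [Vval_eq]
  refine integral_integral_ciSup_gaussPi μ fun a => ?_
  have hx := mul_nonneg hb (hρ a)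
  have hy := mul_nonneg hB (hρ a)
  rw [sq_sub_posteriorVar (hs a) (hσ a) hx, Real.sq_sqrt (varReduction_nonneg hx),
    Real.sq_sqrt (varReduction_nonneg hy), add_mul,
    Real.sq_sqrt (varReduction_nonneg (add_nonneg hx hy)), varReduction_add (hs a) (hσ a) hx hy]
  rfl

end Posterior

/-- A value function that agrees, on positive standard deviations, with a jointly measurable
function and grows at most linearly. -/
structure IsRegularValue {K : ℕ} (W : (Fin K → ℝ) → (Fin K → ℝ) → ℝ) : Prop where
  exists_measurable : ∃ G : (Fin K → ℝ) × (Fin K → ℝ) → ℝ, Measurable G ∧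
    ∀ μ σ, (∀ a, 0 < σ a) → W μ σ = G (μ, σ)
  exists_bound : ∃ C : ℝ, 0 ≤ C ∧
    ∀ μ σ, (∀ a, 0 < σ a) → |W μ σ| ≤ ∑ a, (|μ a| + C * σ a)

namespace IsRegularValue

variable {K : ℕ} {W : (Fin K → ℝ) → (Fin K → ℝ) → ℝ} {s ρ μ σ : Fin K → ℝ} {b : ℝ}

theorem ciSup : IsRegularValue fun (μ _ : Fin K → ℝ) => ⨆ a, μ a where
  exists_measurable :=
    ⟨fun p => ⨆ a, p.1 a, Measurable.iSup fun a => by fun_prop, fun _ _ _ => rfl⟩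
  exists_bound := ⟨0, le_rfl, fun μ _ _ => by simpa using abs_ciSup_le_sum_abs μ⟩

theorem integrable_bound (C : ℝ) :
    Integrable (fun z : Fin K → ℝ => ∑ a, (|μ a| + σ a * |z a| + C * σ a)) (gaussPi K) :=
  integrable_finsetSum _ fun a _ =>
    ((integrable_const _).add ((integrable_eval_gaussPi a).abs.const_mul _)).add
      (integrable_const _)

theorem abs_posterior_le {C : ℝ} (hC : 0 ≤ C)
    (hW : ∀ μ σ, (∀ a, 0 < σ a) → |W μ σ| ≤ ∑ a, (|μ a| + C * σ a))
    (hs : ∀ a, 0 < s a) (hσ : ∀ a, 0 < σ a) (hρ : ∀ a, 0 ≤ ρ a) (hb : 0 ≤ b) (z : Fin K → ℝ) :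
    |W (posteriorMean s ρ μ σ b z) (posteriorSd s ρ σ b)|
      ≤ ∑ a, (|μ a| + σ a * |z a| + C * σ a) :=
  (hW _ _ (posteriorSd_pos hσ hρ hb)).trans <| Finset.sum_le_sum fun a _ =>
    add_le_add (abs_posteriorMean_le hσ hρ hb z a)
      (mul_le_mul_of_nonneg_left (posteriorSd_le hs hσ hρ hb a) hC)

theorem integrable_posterior (hW : IsRegularValue W) (hs : ∀ a, 0 < s a) (hσ : ∀ a, 0 < σ a)
    (hρ : ∀ a, 0 ≤ ρ a) (hb : 0 ≤ b) :
    Integrable (fun z => W (posteriorMean s ρ μ σ b z) (posteriorSd s ρ σ b)) (gaussPi K) := by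
  obtain ⟨G, hG, hWG⟩ := hW.exists_measurable
  obtain ⟨C, hC, hWC⟩ := hW.exists_bound
  refine (integrable_bound (μ := μ) (σ := σ) C).mono' ?_
    (ae_of_all _ fun z => abs_posterior_le hC hWC hs hσ hρ hb z)
  simp only [hWG _ _ (posteriorSd_pos hσ hρ hb)]
  refine (hG.comp (Measurable.prodMk ?_ measurable_const)).aestronglyMeasurable
  unfold posteriorMean
  fun_prop

theorem integral_posterior (hW : IsRegularValue W) (hs : ∀ a, 0 < s a) (hb : 0 ≤ b)
    {r : (Fin K → ℝ) → (Fin K → ℝ) → Fin K → ℝ}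
    (hr : Measurable fun p : (Fin K → ℝ) × (Fin K → ℝ) => r p.1 p.2)
    (hr0 : ∀ μ σ, (∀ a, 0 < σ a) → ∀ a, 0 ≤ r μ σ a)
    {W' : (Fin K → ℝ) → (Fin K → ℝ) → ℝ}
    (hW' : ∀ μ σ, (∀ a, 0 < σ a) → W' μ σ =
      ∫ z, W (posteriorMean s (r μ σ) μ σ b z) (posteriorSd s (r μ σ) σ b) ∂gaussPi K) :
    IsRegularValue W' where
  exists_measurable := by
    obtain ⟨G, hG, hWG⟩ := hW.exists_measurable
    refine ⟨fun p => ∫ z, G (posteriorMean s (r p.1 p.2) p.1 p.2 b z,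
      posteriorSd s (r p.1 p.2) p.2 b) ∂gaussPi K, ?_, fun μ σ hσ => ?_⟩
    · refine (StronglyMeasurable.integral_prod_right'
        (f := fun q : ((Fin K → ℝ) × (Fin K → ℝ)) × (Fin K → ℝ) =>
          G (posteriorMean s (r q.1.1 q.1.2) q.1.1 q.1.2 b q.2,
            posteriorSd s (r q.1.1 q.1.2) q.1.2 b)) ?_).measurable
      refine (hG.comp ?_).stronglyMeasurable
      have hra (a : Fin K) : Measurable
          fun q : ((Fin K → ℝ) × (Fin K → ℝ)) × (Fin K → ℝ) => r q.1.1 q.1.2 a :=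
        (measurable_pi_apply a).comp (hr.comp measurable_fst)
      unfold posteriorMean posteriorSd posteriorVar
      fun_prop
    · rw [hW' μ σ hσ]
      simp only [hWG _ _ (posteriorSd_pos hσ (hr0 μ σ hσ) hb)]
  exists_bound := by
    obtain ⟨C, hC, hWC⟩ := hW.exists_bound
    refine ⟨∫ x, |x| ∂gaussianReal 0 1 + C,
      add_nonneg (integral_nonneg fun _ => abs_nonneg _) hC, fun μ σ hσ => ?_⟩
    have hle := norm_integral_le_of_norm_le
      (f := fun z => W (posteriorMean s (r μ σ) μ σ b z) (posteriorSd s (r μ σ) σ b))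
      (integrable_bound (μ := μ) (σ := σ) C)
      (ae_of_all _ fun z => abs_posterior_le hC hWC hs hσ (hr0 μ σ hσ) hb z)
    rw [hW' μ σ hσ]
    refine hle.trans_eq ?_
    have hi (a : Fin K) : Integrable (fun z : Fin K → ℝ => σ a * |z a|) (gaussPi K) :=
      (integrable_eval_gaussPi a).abs.const_mul _
    have habs (a : Fin K) : ∫ z : Fin K → ℝ, |z a| ∂gaussPi K = ∫ x, |x| ∂gaussianReal 0 1 :=
      integral_comp_eval (μ := fun _ : Fin K => gaussianReal 0 1) (f := fun x : ℝ => |x|)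
        (by fun_prop)
    have hi' (a : Fin K) : Integrable (fun z : Fin K → ℝ => |μ a| + σ a * |z a|) (gaussPi K) :=
      (integrable_const _).add (hi a)
    rw [integral_finsetSum]
    swap
    · exact fun a _ => (hi' a).add (integrable_const _)
    refine Finset.sum_congr rfl fun a _ => ?_
    rw [integral_add (hi' a) (integrable_const _),
      integral_add (integrable_const _) (hi a), integral_const_mul, habs]
    simp
    ring

end IsRegularValue

/-- The Residual Horizon Optimization value functions `W_t` dominate
the value of every constant allocation `ρ̄ ∈ Δ_K` (with residual budget `b̄_t`); in
particular they dominate the value of the uniform allocation. -/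
theorem stmt2
    (K T : ℕ) (hK : 0 < K) (hT : 1 ≤ T)
    (b : ℕ → ℝ) (hb : ∀ t, t < T → 0 < b t)
    (s : Fin K → ℝ) (hs : ∀ a, 0 < s a)
    (bbar : ℕ → ℝ) (hbbar : ∀ t, bbar t = ∑ v ∈ Finset.Ico t T, b v)
    (ρ : ℕ → (Fin K → ℝ) → (Fin K → ℝ) → (Fin K → ℝ))
    (hρmeas : ∀ t, Measurable (fun p : (Fin K → ℝ) × (Fin K → ℝ) => ρ t p.1 p.2))
    (hρopt : ∀ t, t < T → ∀ μ σ : Fin K → ℝ, (∀ a, 0 < σ a) →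
      ρ t μ σ ∈ simplex K ∧
        ∀ ρ' ∈ simplex K, Vval K s ρ' μ σ (bbar t) ≤ Vval K s (ρ t μ σ) μ σ (bbar t))
    (W : ℕ → (Fin K → ℝ) → (Fin K → ℝ) → ℝ)
    (hWT : ∀ μ σ : Fin K → ℝ, W T μ σ = ⨆ a, μ a)
    (hWrec : ∀ t, t < T → ∀ μ σ : Fin K → ℝ, (∀ a, 0 < σ a) →
      W t μ σ = ∫ z, W (t + 1)
          (fun a => μ a + Real.sqrt ((σ a) ^ 2
              - (((σ a) ^ 2)⁻¹ + ((s a) ^ 2)⁻¹ * b t * ρ t μ σ a)⁻¹) * z a)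
          (fun a => Real.sqrt ((((σ a) ^ 2)⁻¹ + ((s a) ^ 2)⁻¹ * b t * ρ t μ σ a)⁻¹))
        ∂(gaussPi K)) :
    ∀ t, t < T → ∀ μ σ : Fin K → ℝ, (∀ a, 0 < σ a) →
      (∀ ρ' ∈ simplex K, Vval K s ρ' μ σ (bbar t) ≤ W t μ σ) ∧
        Vval K s (fun _ => 1 / (K : ℝ)) μ σ (bbar t) ≤ W t μ σ := by
  simp only [mul_assoc] at hWrec
  have main : ∀ n t, t + n = T → IsRegularValue (W t) ∧
      ∀ μ σ : Fin K → ℝ, (∀ a, 0 < σ a) →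
        ∀ ρ' ∈ simplex K, Vval K s ρ' μ σ (bbar t) ≤ W t μ σ := by
    intro n
    induction n with
    | zero =>
      rintro t rfl
      have hW : W t = fun μ _ => ⨆ a, μ a := funext₂ hWT
      refine ⟨hW ▸ IsRegularValue.ciSup, fun μ σ _ ρ' _ => ?_⟩
      have hB : bbar t = 0 := by simp [hbbar]
      rw [hB, Vval_zero, hW]
    | succ n ih =>
      intro t ht
      have htT : t < T := by omega
      obtain ⟨hreg, hdom⟩ := ih (t + 1) (by omega)
      have hb0 := (hb t htT).le
      have hB0 : 0 ≤ bbar (t + 1) := by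
        rw [hbbar]
        exact Finset.sum_nonneg fun v hv => (hb v (Finset.mem_Ico.1 hv).2).le
      have hsplit : bbar t = b t + bbar (t + 1) := by
        rw [hbbar, hbbar, Finset.sum_eq_sum_Ico_succ_bot htT]
      have hρ0 : ∀ μ σ : Fin K → ℝ, (∀ a, 0 < σ a) → ∀ a, 0 ≤ ρ t μ σ a :=
        fun μ σ hσ => (hρopt t htT μ σ hσ).1.1
      refine ⟨hreg.integral_posterior hs hb0 (hρmeas t) hρ0 (hWrec t htT),
        fun μ σ hσ ρ' hρ' => ?_⟩
      obtain ⟨hmem, hopt⟩ := hρopt t htT μ σ hσ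
      refine (hopt ρ' hρ').trans ?_
      rw [hsplit, ← integral_Vval_posterior hs hσ hmem.1 hb0 hB0, hWrec t htT μ σ hσ]
      exact integral_mono integrable_Vval_posterior
        (hreg.integrable_posterior hs hσ hmem.1 hb0)
        fun z => hdom _ _ (posteriorSd_pos hσ hmem.1 hb0) _ hmem
  intro t ht μ σ hσ
  have hdom := (main (T - t) t (by omega)).2 μ σ hσ
  have hK' : (K : ℝ) ≠ 0 := by exact_mod_cast hK.ne'
  exact ⟨hdom, hdom _ ⟨fun _ => by positivity, by simp [hK']⟩⟩
end

section
/- For every arm a, the partial derivative ∂V/∂ρ_a (ρ, α) exists for all α > 0, and lim_{α → 0⁺} α⁻¹ · ∂V/∂ρ_a (ρ, α) = (s_a² / (2 ρ_a²)) · E[(1/σ_a) · φ((θ_a* − μ_a)/σ_a)]. -/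
open MeasureTheory ProbabilityTheory Filter Topology

/-- Standard normal density `φ`. -/
noncomputable def stdNormalPDF (x : ℝ) : ℝ :=
  (Real.sqrt (2 * Real.pi))⁻¹ * Real.exp (-(x ^ 2) / 2)

/-- Scaled planning objective
`V(ρ, α) = E[max_a { μ_a + σ_a sqrt(ρ_a σ_a² / (α s_a² + ρ_a σ_a²)) Z_a }]`,
where `α` plays the role of the inverse residual sample budget. -/
noncomputable def Vplan (K : ℕ) (μ σ s : Fin K → ℝ) (ρ : Fin K → ℝ) (α : ℝ) : ℝ :=
  ∫ z, (⨆ a, (μ a + σ a * Real.sqrt (ρ a * (σ a) ^ 2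
      / (α * (s a) ^ 2 + ρ a * (σ a) ^ 2)) * z a)) ∂(gaussPi K)

lemma stdNormalPDF_eq_gaussianPDFReal (x : ℝ) : stdNormalPDF x = gaussianPDFReal 0 1 x := by
  simp [stdNormalPDF, gaussianPDFReal]

@[fun_prop]
lemma continuous_stdNormalPDF : Continuous stdNormalPDF := by
  unfold stdNormalPDF
  fun_prop

lemma stdNormalPDF_nonneg (x : ℝ) : 0 ≤ stdNormalPDF x := by
  unfold stdNormalPDF
  positivity

lemma stdNormalPDF_le_one (x : ℝ) : stdNormalPDF x ≤ 1 := by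
  have h1 : (Real.sqrt (2 * Real.pi))⁻¹ ≤ 1 := by
    refine inv_le_one_of_one_le₀ (Real.one_le_sqrt.2 ?_)
    linarith [Real.two_le_pi]
  have h2 : Real.exp (-(x ^ 2) / 2) ≤ 1 := Real.exp_le_one_iff.2 (by nlinarith [sq_nonneg x])
  exact mul_le_one₀ h1 (Real.exp_nonneg _) h2

lemma norm_stdNormalPDF_le_one (x : ℝ) : ‖stdNormalPDF x‖ ≤ 1 := by
  rw [Real.norm_of_nonneg (stdNormalPDF_nonneg x)]
  exact stdNormalPDF_le_one x

lemma hasDerivAt_neg_stdNormalPDF (x : ℝ) :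
    HasDerivAt (fun y => -stdNormalPDF y) (stdNormalPDF x * x) x := by
  unfold stdNormalPDF
  have h : HasDerivAt (fun y : ℝ => -(y ^ 2) / 2) (-x) x := by
    refine (((hasDerivAt_pow 2 x).neg).div_const 2).congr_deriv ?_
    norm_num
    ring
  refine ((h.exp.const_mul (Real.sqrt (2 * Real.pi))⁻¹).neg).congr_deriv ?_
  ring

lemma integrable_stdNormalPDF_mul : Integrable fun x : ℝ => stdNormalPDF x * x := by
  refine ((integrable_mul_exp_neg_mul_sq (b := 1 / 2) (by norm_num)).const_mul
    (Real.sqrt (2 * Real.pi))⁻¹).congr (ae_of_all _ fun x => ?_)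
  simp only [stdNormalPDF]
  rw [show -(x ^ 2) / 2 = -(1 / 2) * x ^ 2 by ring]
  ring

lemma tendsto_stdNormalPDF_atTop : Tendsto stdNormalPDF atTop (𝓝 0) := by
  unfold stdNormalPDF
  have h : Tendsto (fun x : ℝ => -(x ^ 2) / 2) atTop atBot := by
    refine Tendsto.atBot_div_const (by norm_num) ?_
    exact tendsto_neg_atTop_atBot.comp (tendsto_pow_atTop two_ne_zero)
  simpa using (Real.tendsto_exp_atBot.comp h).const_mul (Real.sqrt (2 * Real.pi))⁻¹

/-- The truncated first moment of a standard Gaussian. -/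
lemma integral_indicator_Ioi_gaussianReal (c : ℝ) :
    ∫ t, (Set.Ioi c).indicator (fun t => t) t ∂(gaussianReal 0 1) = stdNormalPDF c := by
  rw [integral_gaussianReal_eq_integral_smul one_ne_zero]
  have h : (fun x => gaussianPDFReal 0 1 x • (Set.Ioi c).indicator (fun t => t) x)
      = (Set.Ioi c).indicator fun x => stdNormalPDF x * x := by
    ext x
    by_cases hx : x ∈ Set.Ioi c <;> simp [hx, stdNormalPDF_eq_gaussianPDFReal]
  rw [h, integral_indicator measurableSet_Ioi,
    integral_Ioi_of_hasDerivAt_of_tendsto' (fun x _ => hasDerivAt_neg_stdNormalPDF x)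
      integrable_stdNormalPDF_mul.integrableOn (by simpa using tendsto_stdNormalPDF_atTop.neg)]
  simp

lemma integrable_id_gaussianReal : Integrable (fun t : ℝ => t) (gaussianReal 0 1) :=
  (memLp_id_gaussianReal (μ := 0) (v := 1) 1).integrable le_rfl

/-- The scale derivative of the expected maximum of a constant and a Gaussian. -/
lemma hasDerivAt_integral_max_gaussianReal (m c : ℝ) {τ : ℝ} (hτ : 0 < τ) :
    HasDerivAt (fun τ => ∫ t, max m (c + τ * t) ∂(gaussianReal 0 1))
      (stdNormalPDF ((m - c) / τ)) τ := by
  have hint := integrable_id_gaussianReal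
  rw [← integral_indicator_Ioi_gaussianReal]
  refine (hasDerivAt_integral_of_dominated_loc_of_lip (bound := fun t => |t|)
    (F := fun τ t => max m (c + τ * t)) Filter.univ_mem
    (.of_forall fun τ => (by fun_prop : Continuous _).aestronglyMeasurable)
    ((integrable_const m).sup ((integrable_const c).add (hint.const_mul τ)))
    ((measurable_id.indicator measurableSet_Ioi).aestronglyMeasurable)
    (ae_of_all _ fun t => ?_) hint.abs ?_).2
  · refine LipschitzOnWith.of_dist_le_mul fun x _ y _ => ?_
    simp only [Real.dist_eq, Real.coe_nnabs, abs_abs]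
    refine (abs_max_sub_max_le_max _ _ _ _).trans ?_
    rw [sub_self, abs_zero, max_eq_right (abs_nonneg _),
      show c + x * t - (c + y * t) = t * (x - y) by ring, abs_mul]
  · have := nullSingletonClass_gaussianReal (μ := 0) (v := 1) one_ne_zero
    filter_upwards [(Set.countable_singleton ((m - c) / τ)).ae_notMem (gaussianReal 0 1)]
      with t ht
    have hlin : HasDerivAt (fun x : ℝ => c + x * t) t τ := by
      simpa using ((hasDerivAt_id τ).mul_const t).const_add c
    rcases lt_or_gt_of_ne ht with h | h
    · rw [Set.indicator_of_notMem (by simpa using h.le)]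
      rw [lt_div_iff₀ hτ] at h
      refine (hasDerivAt_const τ m).congr_of_eventuallyEq ?_
      filter_upwards [hlin.continuousAt.eventually_lt continuousAt_const
        (by linarith : c + τ * t < m)] with x hx
      exact max_eq_left hx.le
    · rw [Set.indicator_of_mem (by simpa using h)]
      rw [div_lt_iff₀ hτ] at h
      refine hlin.congr_of_eventuallyEq ?_
      filter_upwards [continuousAt_const.eventually_lt hlin.continuousAt
        (by linarith : m < c + τ * t)] with x hx
      exact max_eq_right hx.le

section Resampling

variable {ι α : Type*} [Fintype ι] [DecidableEq ι] [MeasurableSpace α]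

/-- Resampling one coordinate of a product probability measure preserves it. -/
lemma measurePreserving_update_pi (ν : ι → Measure α) [∀ i, IsProbabilityMeasure (ν i)] (a : ι) :
    MeasurePreserving (fun p : (ι → α) × α => Function.update p.1 a p.2)
      ((Measure.pi ν).prod (ν a)) (Measure.pi ν) := by
  have hmeas : Measurable fun p : (ι → α) × α => Function.update p.1 a p.2 :=
    measurable_update'
  refine ⟨hmeas, (Measure.pi_eq fun S hS => ?_).symm⟩
  have hpre : (fun p : (ι → α) × α => Function.update p.1 a p.2) ⁻¹' Set.univ.pi S
      = Set.univ.pi (Function.update S a Set.univ) ×ˢ S a := by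
    ext ⟨z, t⟩
    simp only [Set.mem_preimage, Set.mem_pi, Set.mem_univ, true_imp_iff, Set.mem_prod]
    constructor
    · intro h
      refine ⟨fun i => ?_, by simpa using h a⟩
      rcases eq_or_ne i a with rfl | hi
      · simp
      · simpa [hi] using h i
    · rintro ⟨h, ht⟩ i
      rcases eq_or_ne i a with rfl | hi
      · simpa using ht
      · simpa [hi] using h i
  rw [Measure.map_apply hmeas (MeasurableSet.univ_pi hS), hpre, Measure.prod_prod,
    Measure.pi_pi, ← Finset.mul_prod_erase _ _ (Finset.mem_univ a),
    ← Finset.mul_prod_erase _ (fun i => ν i (S i)) (Finset.mem_univ a)]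
  rw [Finset.prod_congr rfl fun i hi => by
    rw [Function.update_of_ne (Finset.ne_of_mem_erase hi)]]
  simp [mul_comm]

end Resampling

section Maxima

variable {ι : Type*} [Finite ι]

lemma ciSup_eq_max_ciSup_ne [Nontrivial ι] (a : ι) (f : ι → ℝ) :
    ⨆ b, f b = max (⨆ b : {b : ι // b ≠ a}, f b) (f a) := by
  have : Nonempty {b : ι // b ≠ a} := let ⟨b, hb⟩ := exists_ne a; ⟨⟨b, hb⟩⟩
  have hf : BddAbove (Set.range f) := Set.finite_range f |>.bddAbove
  refine le_antisymm (ciSup_le fun b => ?_)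
    (max_le (ciSup_le fun b => le_ciSup hf _) (le_ciSup hf a))
  rcases eq_or_ne b a with rfl | hb
  · exact le_max_right _ _
  · exact le_max_of_le_left (le_ciSup (f := fun b : {b : ι // b ≠ a} => f b)
      (Set.finite_range _).bddAbove ⟨b, hb⟩)

lemma Filter.Tendsto.ciSup_nhds [Nonempty ι] {β : Type*} {l : Filter β} {f : ι → β → ℝ} {g : ι → ℝ}
    (h : ∀ i, Tendsto (f i) l (𝓝 (g i))) :
    Tendsto (fun x => ⨆ i, f i x) l (𝓝 (⨆ i, g i)) := by
  have := Fintype.ofFinite ι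
  simp only [← Finset.sup'_univ_eq_ciSup]
  exact Filter.Tendsto.finset_sup'_nhds_apply _ fun i _ => h i

lemma continuous_ciSup [Nonempty ι] {β : Type*} [TopologicalSpace β] {f : ι → β → ℝ}
    (h : ∀ i, Continuous (f i)) : Continuous fun x => ⨆ i, f i x :=
  continuous_iff_continuousAt.2 fun _ => Filter.Tendsto.ciSup_nhds fun i => (h i).continuousAt

lemma integrable_ciSup_s5 [Nonempty ι] {β : Type*} [MeasurableSpace β] {ν : Measure β}
    {f : ι → β → ℝ} (h : ∀ i, Integrable (f i) ν) : Integrable (fun x => ⨆ i, f i x) ν := by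
  have := Fintype.ofFinite ι
  simp only [← Finset.sup'_univ_eq_ciSup]
  have : ∀ (s : Finset ι) (hs : s.Nonempty), Integrable (fun x => s.sup' hs fun i => f i x) ν := by
    intro s hs
    induction hs using Finset.Nonempty.cons_induction with
    | singleton i => simpa using h i
    | cons i s hi hs ih =>
      simp only [Finset.sup'_cons hs]
      exact (h i).sup ih
  exact this _ _

end Maxima

section Planning

variable {K : ℕ}

instance : IsProbabilityMeasure (gaussPi K) := by
  unfold gaussPi
  infer_instance

lemma integrable_ciSup_affine_gaussPi [Nonempty (Fin K)] (μ c : Fin K → ℝ) :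
    Integrable (fun z => ⨆ b, (μ b + c b * z b)) (gaussPi K) :=
  integrable_ciSup_s5 fun b => (integrable_const _).add
    ((integrable_comp_eval (μ := fun _ : Fin K => gaussianReal 0 1) (i := b)
      integrable_id_gaussianReal).const_mul _)

/-- `max_{b ≠ a} (μ_b + c_b z_b)`. -/
noncomputable def rivalMax (μ c : Fin K → ℝ) (a : Fin K) (z : Fin K → ℝ) : ℝ :=
  ⨆ b : {b : Fin K // b ≠ a}, (μ b.1 + c b.1 * z b.1)

variable [Nontrivial (Fin K)]

instance (a : Fin K) : Nonempty {b : Fin K // b ≠ a} :=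
  let ⟨b, hb⟩ := exists_ne a
  ⟨⟨b, hb⟩⟩

lemma continuous_rivalMax (μ c : Fin K → ℝ) (a : Fin K) : Continuous (rivalMax μ c a) :=
  continuous_ciSup fun b => by fun_prop

lemma ciSup_affine_update (μ c : Fin K → ℝ) (a : Fin K) (τ : ℝ) (z : Fin K → ℝ) (t : ℝ) :
    ⨆ b, (μ b + Function.update c a τ b * Function.update z a t b)
      = max (rivalMax μ c a z) (μ a + τ * t) := by
  rw [ciSup_eq_max_ciSup_ne a, Function.update_self, Function.update_self, rivalMax]
  congr 2
  ext b
  rw [Function.update_of_ne b.2, Function.update_of_ne b.2]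

lemma integrable_max_rivalMax (μ c : Fin K → ℝ) (a : Fin K) (τ : ℝ) :
    Integrable (fun p : (Fin K → ℝ) × ℝ => max (rivalMax μ c a p.1) (μ a + τ * p.2))
      ((gaussPi K).prod (gaussianReal 0 1)) := by
  have hmp := measurePreserving_update_pi (fun _ : Fin K => gaussianReal 0 1) a
  have h := hmp.integrable_comp_of_integrable
    (integrable_ciSup_affine_gaussPi μ (Function.update c a τ))
  simp only [Function.comp_def, ciSup_affine_update] at h
  exact h

lemma integral_ciSup_affine_update (μ c : Fin K → ℝ) (a : Fin K) (τ : ℝ) :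
    ∫ z, (⨆ b, (μ b + Function.update c a τ b * z b)) ∂(gaussPi K)
      = ∫ z, ∫ t, max (rivalMax μ c a z) (μ a + τ * t) ∂(gaussianReal 0 1) ∂(gaussPi K) := by
  have hmp := measurePreserving_update_pi (fun _ : Fin K => gaussianReal 0 1) a
  rw [← integral_prod _ (integrable_max_rivalMax μ c a τ)]
  simp only [← ciSup_affine_update]
  conv_lhs => rw [gaussPi, ← hmp.map_eq]
  rw [integral_map hmp.measurable.aemeasurable
    (continuous_ciSup fun b => by fun_prop).aestronglyMeasurable]
  rfl

/-- The derivative of an expected Gaussian maximum in the scale of one coordinate. -/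
lemma hasDerivAt_integral_ciSup_affine_update (μ c : Fin K → ℝ) (a : Fin K) {τ : ℝ} (hτ : 0 < τ) :
    HasDerivAt (fun τ => ∫ z, (⨆ b, (μ b + Function.update c a τ b * z b)) ∂(gaussPi K))
      (∫ z, stdNormalPDF ((rivalMax μ c a z - μ a) / τ) ∂(gaussPi K)) τ := by
  simp only [integral_ciSup_affine_update]
  have hint := fun τ => (integrable_max_rivalMax μ c a τ).integral_prod_left
  have hM := continuous_rivalMax μ c a
  exact (hasDerivAt_integral_of_dominated_loc_of_deriv_le (bound := fun _ => (1 : ℝ))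
    (F' := fun τ z => stdNormalPDF ((rivalMax μ c a z - μ a) / τ)) (Ioi_mem_nhds hτ)
    (.of_forall fun τ => (hint τ).aestronglyMeasurable) (hint τ)
    (by fun_prop : Continuous _).aestronglyMeasurable
    (ae_of_all _ fun z x _ => norm_stdNormalPDF_le_one _) (integrable_const _)
    (ae_of_all _ fun z x hx =>
      hasDerivAt_integral_max_gaussianReal (rivalMax μ c a z) (μ a) hx)).2

end Planning

/-- The standard deviation of the posterior mean of an arm with prior standard deviation `σ`,
noise level `s` and sampling share `x`. -/
noncomputable def preposteriorSd (σ s α x : ℝ) : ℝ :=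
  σ * Real.sqrt (x * σ ^ 2 / (α * s ^ 2 + x * σ ^ 2))

section PreposteriorSd

variable {σ s α x : ℝ}

lemma preposteriorSd_pos (hσ : 0 < σ) (hα : 0 ≤ α) (hx : 0 < x) :
    0 < preposteriorSd σ s α x := by
  unfold preposteriorSd
  positivity

lemma hasDerivAt_preposteriorSd (hσ : 0 < σ) (hα : 0 ≤ α) (hx : 0 < x) :
    HasDerivAt (preposteriorSd σ s α)
      (α * (σ ^ 4 * s ^ 2 / (2 * preposteriorSd σ s α x * (α * s ^ 2 + x * σ ^ 2) ^ 2))) x := by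
  have hD : α * s ^ 2 + x * σ ^ 2 ≠ 0 := by positivity
  have hnum : HasDerivAt (fun x : ℝ => x * σ ^ 2) (σ ^ 2) x := by
    simpa using (hasDerivAt_id x).mul_const (σ ^ 2)
  have hu := hnum.div (hnum.const_add (α * s ^ 2)) hD
  have h := (hu.sqrt (by simp only [Pi.div_apply]; positivity)).const_mul σ
  refine h.congr_deriv ?_
  have hr : 0 < Real.sqrt (x * σ ^ 2 / (α * s ^ 2 + x * σ ^ 2)) := by positivity
  simp only [preposteriorSd, Pi.div_apply]
  field_simp
  ring

lemma tendsto_preposteriorSd (hσ : 0 < σ) (hx : 0 < x) :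
    Tendsto (fun α => preposteriorSd σ s α x) (𝓝[>] 0) (𝓝 σ) := by
  have hD : (0 : ℝ) * s ^ 2 + x * σ ^ 2 ≠ 0 := by positivity
  have h : ContinuousAt (fun α => preposteriorSd σ s α x) 0 := by
    unfold preposteriorSd
    fun_prop (disch := exact hD)
  have h0 : preposteriorSd σ s 0 x = σ := by
    have : x * σ ^ 2 ≠ 0 := by positivity
    simp [preposteriorSd, div_self this]
  simpa only [h0] using h.tendsto.mono_left nhdsWithin_le_nhds

end PreposteriorSd

section VplanDerivative

variable {K : ℕ} {μ σ s ρ : Fin K → ℝ}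

lemma Vplan_update (a : Fin K) (x α : ℝ) :
    Vplan K μ σ s (Function.update ρ a x) α
      = ∫ z, (⨆ b, (μ b + Function.update (fun b => preposteriorSd (σ b) (s b) α (ρ b)) a
          (preposteriorSd (σ a) (s a) α x) b * z b)) ∂(gaussPi K) := by
  unfold Vplan
  congr! 5 with z b
  rcases eq_or_ne b a with rfl | hb
  · simp [preposteriorSd]
  · simp [preposteriorSd, hb]

variable [Nontrivial (Fin K)]

lemma hasDerivAt_Vplan_update (hσ : ∀ a, 0 < σ a) (hρ : ∀ a, 0 < ρ a) (a : Fin K) {α : ℝ}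
    (hα : 0 ≤ α) :
    HasDerivAt (fun x => Vplan K μ σ s (Function.update ρ a x) α)
      ((∫ z, stdNormalPDF ((rivalMax μ (fun b => preposteriorSd (σ b) (s b) α (ρ b)) a z - μ a)
          / preposteriorSd (σ a) (s a) α (ρ a)) ∂(gaussPi K))
        * (α * ((σ a) ^ 4 * (s a) ^ 2 / (2 * preposteriorSd (σ a) (s a) α (ρ a)
          * (α * (s a) ^ 2 + ρ a * (σ a) ^ 2) ^ 2)))) (ρ a) := by
  simp only [Vplan_update]
  exact (hasDerivAt_integral_ciSup_affine_update μ _ a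
    (preposteriorSd_pos (hσ a) hα (hρ a))).comp (ρ a)
      (hasDerivAt_preposteriorSd (hσ a) hα (hρ a))

lemma tendsto_integral_stdNormalPDF_rivalMax (hσ : ∀ a, 0 < σ a) (hρ : ∀ a, 0 < ρ a)
    (a : Fin K) :
    Tendsto (fun α => ∫ z, stdNormalPDF
        ((rivalMax μ (fun b => preposteriorSd (σ b) (s b) α (ρ b)) a z - μ a)
          / preposteriorSd (σ a) (s a) α (ρ a)) ∂(gaussPi K)) (𝓝[>] 0)
      (𝓝 (∫ z, stdNormalPDF ((rivalMax μ σ a z - μ a) / σ a) ∂(gaussPi K))) := by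
  have hsd := fun b => tendsto_preposteriorSd (s := s b) (hσ b) (hρ b)
  refine tendsto_integral_filter_of_dominated_convergence (fun _ => 1)
    (.of_forall fun α => ?_) (.of_forall fun α => ae_of_all _ fun z =>
      norm_stdNormalPDF_le_one _) (integrable_const _) (ae_of_all _ fun z => ?_)
  · have hM := continuous_rivalMax μ (fun b => preposteriorSd (σ b) (s b) α (ρ b)) a
    exact (by fun_prop : Continuous _).aestronglyMeasurable
  · refine (continuous_stdNormalPDF.tendsto _).comp (Tendsto.div (Tendsto.sub_const ?_ _)
      (hsd a) (hσ a).ne')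
    exact Filter.Tendsto.ciSup_nhds fun b => ((hsd b).mul_const _).const_add _

end VplanDerivative

/-- For every arm `a`, `∂V/∂ρ_a(ρ, α)` exists for all `α > 0`, and
`lim_{α → 0⁺} α⁻¹ ∂V/∂ρ_a (ρ, α) = (s_a²/(2ρ_a²)) E[(1/σ_a) φ((θ_a* − μ_a)/σ_a)]`,
where `θ_a* = max_{a'≠a} (μ_{a'} + σ_{a'} Z_{a'})`. -/
theorem stmt5 (K : ℕ) (hK : 2 ≤ K)
    (μ σ s : Fin K → ℝ) (hσ : ∀ a, 0 < σ a) (hs : ∀ a, 0 < s a)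
    (ρ : Fin K → ℝ) (hρ0 : ∀ a, 0 < ρ a) (hρ1 : ∑ a, ρ a = 1) :
    ∀ a : Fin K,
      (∀ α : ℝ, 0 < α →
        DifferentiableAt ℝ (fun x => Vplan K μ σ s (Function.update ρ a x) α) (ρ a)) ∧
      Tendsto
        (fun α : ℝ => α⁻¹ * deriv (fun x => Vplan K μ σ s (Function.update ρ a x) α) (ρ a))
        (𝓝[>] 0)
        (𝓝 ((s a) ^ 2 / (2 * (ρ a) ^ 2)
          * ∫ z, (1 / σ a) * stdNormalPDF
              (((⨆ a' : {b : Fin K // b ≠ a}, (μ a'.1 + σ a'.1 * z a'.1)) - μ a) / σ a)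
            ∂(gaussPi K))) := by
  have : Nontrivial (Fin K) := Fin.nontrivial_iff_two_le.2 hK
  intro a
  have hderiv := fun (α : ℝ) (hα : 0 < α) =>
    hasDerivAt_Vplan_update (μ := μ) (s := s) hσ hρ0 a hα.le
  refine ⟨fun α hα => (hderiv α hα).differentiableAt, ?_⟩
  have hσa := hσ a
  have hρa := hρ0 a
  have hfac : Tendsto (fun α : ℝ => (σ a) ^ 4 * (s a) ^ 2
      / (2 * preposteriorSd (σ a) (s a) α (ρ a) * (α * (s a) ^ 2 + ρ a * (σ a) ^ 2) ^ 2))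
      (𝓝[>] 0) (𝓝 ((σ a) ^ 4 * (s a) ^ 2
        / (2 * σ a * (0 * (s a) ^ 2 + ρ a * (σ a) ^ 2) ^ 2))) := by
    refine Tendsto.div tendsto_const_nhds (((tendsto_preposteriorSd hσa hρa).const_mul 2).mul
      ?_) (by positivity)
    exact (((by fun_prop : Continuous fun α : ℝ =>
      (α * (s a) ^ 2 + ρ a * (σ a) ^ 2) ^ 2).tendsto 0).mono_left nhdsWithin_le_nhds)
  have hlim := (tendsto_integral_stdNormalPDF_rivalMax (μ := μ) (s := s) hσ hρ0 a).mul hfac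
  rw [integral_const_mul]
  convert hlim.congr' ?_ using 2
  · simp only [rivalMax]
    field_simp
    ring
  · filter_upwards [self_mem_nhdsWithin] with α hα
    rw [(hderiv α hα).deriv]
    field_simp [(Set.mem_Ioi.1 hα).ne']
end

section
/- For every ε > 0 with ε < 1/K, there exist α₀ > 0 and m > 0 such that for all α ∈ (0, α₀), the function ρ ↦ α⁻¹ V(ρ, α) is m-strongly concave on the truncated simplex Δ_K^ε; that is, ρ ↦ α⁻¹ V(ρ, α) + (m/2)‖ρ‖² is concave on Δ_K^ε. -/
open MeasureTheory ProbabilityTheory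

theorem abs_ciSup_sub_ciSup_le {ι : Type*} [Finite ι] [Nonempty ι] {f g : ι → ℝ} {C : ℝ}
    (h : ∀ i, |f i - g i| ≤ C) : |(⨆ i, f i) - ⨆ i, g i| ≤ C := by
  have hf : BddAbove (Set.range f) := (Set.finite_range f).bddAbove
  have hg : BddAbove (Set.range g) := (Set.finite_range g).bddAbove
  have h₁ : (⨆ i, f i) ≤ (⨆ i, g i) + C :=
    ciSup_le fun i => by linarith [le_ciSup hg i, (abs_le.mp (h i)).2]
  have h₂ : (⨆ i, g i) ≤ (⨆ i, f i) + C :=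
    ciSup_le fun i => by linarith [le_ciSup hf i, (abs_le.mp (h i)).1]
  exact abs_le.mpr ⟨by linarith, by linarith⟩

theorem gaussianPDFReal_zero_one (x : ℝ) :
    gaussianPDFReal 0 1 x = (√(2 * Real.pi))⁻¹ * Real.exp (-x ^ 2 / 2) := by
  simp [gaussianPDFReal]

theorem hasDerivAt_gaussianPDFReal_zero_one (x : ℝ) :
    HasDerivAt (gaussianPDFReal 0 1) (-(x * gaussianPDFReal 0 1 x)) x := by
  have h : HasDerivAt (fun y : ℝ => (√(2 * Real.pi))⁻¹ * Real.exp (-y ^ 2 / 2))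
      ((√(2 * Real.pi))⁻¹ * (Real.exp (-x ^ 2 / 2) * (-(2 * x) / 2))) x := by
    have h0 : HasDerivAt (fun y : ℝ => -y ^ 2 / 2) (-(2 * x) / 2) x := by
      simpa using ((hasDerivAt_pow 2 x).neg).div_const 2
    exact h0.exp.const_mul _
  rw [funext gaussianPDFReal_zero_one]
  convert h using 1
  ring

theorem inv_sqrt_two_pi_le_one : (√(2 * Real.pi))⁻¹ ≤ 1 :=
  inv_le_one_of_one_le₀ (Real.one_le_sqrt.mpr (by linarith [Real.pi_gt_three]))

theorem gaussianPDFReal_zero_one_le_one (x : ℝ) : gaussianPDFReal 0 1 x ≤ 1 := by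
  rw [gaussianPDFReal_zero_one]
  exact mul_le_one₀ inv_sqrt_two_pi_le_one (Real.exp_pos _).le
    (Real.exp_le_one_iff.mpr (by nlinarith [sq_nonneg x]))

theorem abs_mul_gaussianPDFReal_zero_one_le_one (x : ℝ) : |x * gaussianPDFReal 0 1 x| ≤ 1 := by
  have h₀ : |x * gaussianPDFReal 0 1 x| = |x| * gaussianPDFReal 0 1 x := by
    rw [abs_mul, abs_of_nonneg (gaussianPDFReal_nonneg 0 1 x)]
  rw [h₀, gaussianPDFReal_zero_one]
  have h₁ : |x| ≤ Real.exp (x ^ 2 / 2) := by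
    have := Real.add_one_le_exp (x ^ 2 / 2)
    nlinarith [sq_nonneg (|x| - 1), sq_abs x]
  have h₂ : |x| * Real.exp (-x ^ 2 / 2) ≤ 1 := by
    calc |x| * Real.exp (-x ^ 2 / 2) ≤ Real.exp (x ^ 2 / 2) * Real.exp (-x ^ 2 / 2) := by gcongr
      _ = 1 := by rw [← Real.exp_add]; ring_nf; simp
  calc |x| * ((√(2 * Real.pi))⁻¹ * Real.exp (-x ^ 2 / 2))
      = (√(2 * Real.pi))⁻¹ * (|x| * Real.exp (-x ^ 2 / 2)) := by ring
    _ ≤ 1 := mul_le_one₀ inv_sqrt_two_pi_le_one (by positivity) h₂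

theorem abs_gaussianPDFReal_zero_one_sub_le (x y : ℝ) :
    |gaussianPDFReal 0 1 x - gaussianPDFReal 0 1 y| ≤ |x - y| := by
  have h := convex_univ.norm_image_sub_le_of_norm_hasDerivWithin_le (C := 1)
    (fun z _ => (hasDerivAt_gaussianPDFReal_zero_one z).hasDerivWithinAt)
    (fun z _ => by
      rw [norm_neg]; exact abs_mul_gaussianPDFReal_zero_one_le_one z)
    (Set.mem_univ y) (Set.mem_univ x)
  simpa using h

theorem gaussianPDFReal_zero_one_le_of_abs_le {x y : ℝ} (h : |x| ≤ y) :
    gaussianPDFReal 0 1 y ≤ gaussianPDFReal 0 1 x := by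
  simp only [gaussianPDFReal_zero_one]
  have hsq : x ^ 2 ≤ y ^ 2 := sq_le_sq' (by linarith [(abs_le.mp h).1]) (abs_le.mp h).2
  exact mul_le_mul_of_nonneg_left (Real.exp_le_exp.mpr (by linarith)) (by positivity)

/-- The truncated first moment of the standard Gaussian is its density at the threshold. -/
theorem integral_indicator_Ici_gaussianReal (x : ℝ) :
    ∫ t, (Set.Ici x).indicator id t ∂(gaussianReal 0 1) = gaussianPDFReal 0 1 x := by
  rw [integral_gaussianReal_eq_integral_smul one_ne_zero]
  have h₁ : (fun t => gaussianPDFReal 0 1 t • (Set.Ici x).indicator id t)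
      = (Set.Ici x).indicator fun t => t * gaussianPDFReal 0 1 t := by
    ext t
    by_cases ht : t ∈ Set.Ici x <;> simp [ht, mul_comm]
  rw [h₁, integral_indicator measurableSet_Ici, integral_Ici_eq_integral_Ioi]
  have hint : Integrable (fun t : ℝ => t * gaussianPDFReal 0 1 t) := by
    have := (integrable_mul_exp_neg_mul_sq (b := 1 / 2) (by norm_num)).const_mul
      (√(2 * Real.pi))⁻¹
    refine this.congr (Filter.Eventually.of_forall fun t => ?_)
    simp only [gaussianPDFReal_zero_one]
    ring_nf
  have hlim : Filter.Tendsto (fun t => -gaussianPDFReal 0 1 t) Filter.atTop (nhds 0) := by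
    have h : Filter.Tendsto (fun t : ℝ => -t ^ 2 / 2) Filter.atTop Filter.atBot := by
      simp only [neg_div]
      exact Filter.tendsto_neg_atTop_atBot.comp
        ((Filter.tendsto_pow_atTop two_ne_zero).atTop_div_const two_pos)
    have h' := ((Real.tendsto_exp_atBot.comp h).const_mul (√(2 * Real.pi))⁻¹).neg
    simpa [gaussianPDFReal_zero_one, Function.comp_def] using h'
  have h := integral_Ioi_of_hasDerivAt_of_tendsto' (a := x)
    (f := fun t => -gaussianPDFReal 0 1 t) (f' := fun t => t * gaussianPDFReal 0 1 t)
    (fun t _ => by simpa using (hasDerivAt_gaussianPDFReal_zero_one t).fun_neg)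
    hint.integrableOn hlim
  simpa using h

/-- Resampling one coordinate of a standard Gaussian vector preserves its law. -/
theorem measurePreserving_update_gaussPi {K : ℕ} (a : Fin K) :
    MeasurePreserving (fun p : (Fin K → ℝ) × ℝ => Function.update p.1 a p.2)
      ((gaussPi K).prod (gaussianReal 0 1)) (gaussPi K) := by
  have hm : Measurable fun p : (Fin K → ℝ) × ℝ => Function.update p.1 a p.2 := by
    refine measurable_pi_lambda _ fun b => ?_
    by_cases hb : b = a
    · subst hb; simpa using measurable_snd
    · simpa [hb, Function.comp_def] using (measurable_pi_apply b).comp measurable_fst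
  refine ⟨hm, ?_⟩
  symm
  refine Measure.pi_eq fun S hS => ?_
  rw [Measure.map_apply hm (MeasurableSet.univ_pi hS)]
  have hpre : (fun p : (Fin K → ℝ) × ℝ => Function.update p.1 a p.2) ⁻¹' (Set.univ.pi S)
      = (Set.univ.pi (Function.update S a Set.univ)) ×ˢ S a := by
    ext p
    simp only [Set.mem_preimage, Set.mem_pi, Set.mem_univ, true_implies, Set.mem_prod]
    constructor
    · intro h
      refine ⟨fun b => ?_, by simpa using h a⟩
      by_cases hb : b = a
      · subst hb; simp
      · simpa [hb] using h b
    · rintro ⟨h, ha⟩ b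
      by_cases hb : b = a
      · subst hb; simpa using ha
      · simpa [hb] using h b
  rw [hpre, Measure.prod_prod, gaussPi, Measure.pi_pi,
    ← Finset.mul_prod_erase _ _ (Finset.mem_univ a),
    ← Finset.mul_prod_erase _ (fun i => gaussianReal 0 1 (S i)) (Finset.mem_univ a)]
  simp only [Function.update_self, measure_univ, one_mul]
  rw [mul_comm]
  congr 1
  refine Finset.prod_congr rfl fun b hb => ?_
  rw [Function.update_of_ne (Finset.ne_of_mem_erase hb)]

instance isProbabilityMeasure_gaussPi (K : ℕ) : IsProbabilityMeasure (gaussPi K) := by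
  unfold gaussPi; infer_instance

theorem integrable_one_add_sum_abs_gaussPi (K : ℕ) :
    Integrable (fun z : Fin K → ℝ => 1 + ∑ a, |z a|) (gaussPi K) :=
  (integrable_const 1).add (integrable_finsetSum _ fun a _ => (integrable_eval_gaussPi a).abs)

/-- The largest of the affine functions `z ↦ μ a + τ a * z a`. -/
noncomputable def maxValue {K : ℕ} (μ τ z : Fin K → ℝ) : ℝ := ⨆ a, (μ a + τ a * z a)

/-- The value `z a` must reach for `a` to attain `maxValue μ τ z`. -/
noncomputable def threshold {K : ℕ} (μ τ : Fin K → ℝ) (a : Fin K) (z : Fin K → ℝ) : ℝ :=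
  ⨆ b : {b : Fin K // b ≠ a}, (μ b + τ b * z b - μ a) / τ a

/-- The `a`-th partial derivative in `τ` of the expectation of `maxValue μ τ`. -/
noncomputable def meanDensity {K : ℕ} (μ τ : Fin K → ℝ) (a : Fin K) : ℝ :=
  ∫ z, gaussianPDFReal 0 1 (threshold μ τ a z) ∂(gaussPi K)

theorem le_maxValue {K : ℕ} (μ τ z : Fin K → ℝ) (a : Fin K) :
    μ a + τ a * z a ≤ maxValue μ τ z :=
  le_ciSup (f := fun a => μ a + τ a * z a) (Set.finite_range _).bddAbove a

theorem measurable_maxValue {K : ℕ} (μ τ : Fin K → ℝ) : Measurable (maxValue μ τ) := by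
  unfold maxValue
  exact Measurable.iSup fun a => by fun_prop

theorem measurable_threshold {K : ℕ} (μ τ : Fin K → ℝ) (a : Fin K) :
    Measurable (threshold μ τ a) := by
  unfold threshold
  exact Measurable.iSup fun b => by fun_prop

theorem threshold_update {K : ℕ} (μ τ : Fin K → ℝ) (a : Fin K) (z : Fin K → ℝ) (t : ℝ) :
    threshold μ τ a (Function.update z a t) = threshold μ τ a z := by
  unfold threshold
  congr 1
  ext b
  rw [Function.update_of_ne b.2]

theorem le_threshold {K : ℕ} (μ τ z : Fin K → ℝ) {a b : Fin K} (hb : b ≠ a) :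
    (μ b + τ b * z b - μ a) / τ a ≤ threshold μ τ a z :=
  le_ciSup (f := fun b : {b : Fin K // b ≠ a} => (μ b + τ b * z b - μ a) / τ a)
    (Set.finite_range _).bddAbove ⟨b, hb⟩

theorem nonempty_ne {K : ℕ} (hK : 2 ≤ K) (a : Fin K) : Nonempty {b : Fin K // b ≠ a} := by
  have : Nontrivial (Fin K) := Fin.nontrivial_iff_two_le.mpr hK
  obtain ⟨b, hb⟩ := exists_ne a
  exact ⟨⟨b, hb⟩⟩

theorem integrable_maxValue {K : ℕ} (hK : 0 < K) (μ τ : Fin K → ℝ) :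
    Integrable (maxValue μ τ) (gaussPi K) := by
  have : Nonempty (Fin K) := ⟨⟨0, hK⟩⟩
  have hint : Integrable (fun z : Fin K → ℝ => ∑ a, |μ a + τ a * z a|) (gaussPi K) :=
    integrable_finsetSum _ fun a _ =>
      ((integrable_const _).add ((integrable_eval_gaussPi a).const_mul _)).abs
  refine hint.mono' (measurable_maxValue μ τ).aestronglyMeasurable
    (Filter.Eventually.of_forall fun z => ?_)
  obtain ⟨a, ha⟩ := exists_eq_ciSup_of_finite (f := fun a => μ a + τ a * z a)
  rw [Real.norm_eq_abs, maxValue, ← ha]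
  exact Finset.single_le_sum (f := fun a => |μ a + τ a * z a|) (fun _ _ => abs_nonneg _)
    (Finset.mem_univ a)

theorem integrable_gaussianPDFReal_comp {Ω : Type*} [MeasurableSpace Ω] {P : Measure Ω}
    [IsFiniteMeasure P] {f : Ω → ℝ} (hf : Measurable f) :
    Integrable (fun ω => gaussianPDFReal 0 1 (f ω)) P :=
  (integrable_const (1 : ℝ)).mono'
    ((measurable_gaussianPDFReal 0 1).comp hf).aestronglyMeasurable
    (Filter.Eventually.of_forall fun ω => by
      rw [Real.norm_of_nonneg (gaussianPDFReal_nonneg _ _ _)]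
      exact gaussianPDFReal_zero_one_le_one _)

theorem measurableSet_threshold_le {K : ℕ} (μ τ : Fin K → ℝ) (a : Fin K) :
    MeasurableSet {z : Fin K → ℝ | threshold μ τ a z ≤ z a} :=
  measurableSet_le (measurable_threshold μ τ a) (measurable_pi_apply a)

theorem integral_indicator_threshold_le {K : ℕ} (μ τ : Fin K → ℝ) (a : Fin K) :
    ∫ z, {z : Fin K → ℝ | threshold μ τ a z ≤ z a}.indicator (fun z => z a) z ∂(gaussPi K)
      = meanDensity μ τ a := by
  have hint : Integrable ({z : Fin K → ℝ | threshold μ τ a z ≤ z a}.indicator fun z => z a)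
      (gaussPi K) :=
    (integrable_eval_gaussPi a).indicator (measurableSet_threshold_le μ τ a)
  have hmp := measurePreserving_update_gaussPi a
  have hmap := integral_map hmp.measurable.aemeasurable
    (by rw [hmp.map_eq]; exact hint.aestronglyMeasurable)
  rw [hmp.map_eq] at hmap
  have hfub := integral_prod _ (hmp.integrable_comp_of_integrable hint)
  simp only [Function.comp_apply] at hfub
  rw [hmap, hfub, meanDensity]
  refine integral_congr_ae (Filter.Eventually.of_forall fun z => ?_)
  simp only
  rw [← integral_indicator_Ici_gaussianReal]
  congr 1
  ext t
  simp [Set.indicator_apply, threshold_update]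

theorem ae_ne_threshold {K : ℕ} (μ τ : Fin K → ℝ) (a : Fin K) :
    ∀ᵐ z ∂(gaussPi K), z a ≠ threshold μ τ a z := by
  have hs : MeasurableSet {z : Fin K → ℝ | z a = threshold μ τ a z} :=
    measurableSet_eq_fun (measurable_pi_apply a) (measurable_threshold μ τ a)
  have hmp := measurePreserving_update_gaussPi a
  have : NullSingletonClass (gaussianReal 0 1) := nullSingletonClass_gaussianReal one_ne_zero
  rw [ae_iff]
  simp only [ne_eq, not_not]
  rw [← hmp.measure_preimage hs.nullMeasurableSet, Measure.measure_prod_null (hmp.measurable hs)]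
  refine Filter.Eventually.of_forall fun z => ?_
  have : Prod.mk z ⁻¹' ((fun p : (Fin K → ℝ) × ℝ => Function.update p.1 a p.2) ⁻¹'
      {z | z a = threshold μ τ a z}) = {threshold μ τ a z} := by
    ext t
    simp [threshold_update]
  simp only [this, measure_singleton, Pi.zero_apply]

theorem maxValue_add_sum_indicator_le {K : ℕ} (hK : 0 < K) (μ : Fin K → ℝ) {τ : Fin K → ℝ}
    (hτ : ∀ a, 0 < τ a) (τ' : Fin K → ℝ) {z : Fin K → ℝ} (hz : ∀ a, z a ≠ threshold μ τ a z)
    (hne : ∀ a : Fin K, Nonempty {b : Fin K // b ≠ a}) :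
    maxValue μ τ z + ∑ a, (τ' a - τ a) *
        {z : Fin K → ℝ | threshold μ τ a z ≤ z a}.indicator (fun z => z a) z
      ≤ maxValue μ τ' z := by
  have : Nonempty (Fin K) := ⟨⟨0, hK⟩⟩
  obtain ⟨a, ha⟩ := exists_eq_ciSup_of_finite (f := fun a => μ a + τ a * z a)
  change μ a + τ a * z a = maxValue μ τ z at ha
  have hin : threshold μ τ a z ≤ z a := by
    have := hne a
    refine ciSup_le fun b => ?_
    rw [div_le_iff₀ (hτ a)]
    linarith [le_maxValue μ τ z b]
  have hout : ∀ b, b ≠ a → ¬ threshold μ τ b z ≤ z b := fun b hb h => by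
    have h₁ := lt_of_le_of_ne h (hz b).symm
    have h₂ := (le_threshold μ τ z hb.symm).trans_lt h₁
    rw [div_lt_iff₀ (hτ b)] at h₂
    linarith [le_maxValue μ τ z b]
  rw [Finset.sum_eq_single a (fun b _ hb => by simp [hout b hb])
    (fun h => absurd (Finset.mem_univ a) h)]
  rw [Set.indicator_of_mem (by exact hin)]
  linarith [le_maxValue μ τ' z a]

/-- `meanDensity μ τ` is a subgradient at `τ` of the expectation of `maxValue μ τ`. -/
theorem integral_maxValue_add_sum_meanDensity_le {K : ℕ} (hK : 2 ≤ K) (μ : Fin K → ℝ)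
    {τ : Fin K → ℝ} (hτ : ∀ a, 0 < τ a) (τ' : Fin K → ℝ) :
    (∫ z, maxValue μ τ z ∂(gaussPi K)) + ∑ a, (τ' a - τ a) * meanDensity μ τ a
      ≤ ∫ z, maxValue μ τ' z ∂(gaussPi K) := by
  have hint : ∀ a, Integrable (fun z => (τ' a - τ a) *
      {z : Fin K → ℝ | threshold μ τ a z ≤ z a}.indicator (fun z => z a) z) (gaussPi K) :=
    fun a => ((integrable_eval_gaussPi a).indicator (measurableSet_threshold_le μ τ a)).const_mul _
  have hsum := integrable_finsetSum Finset.univ fun a _ => hint a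
  have h : (∫ z, (maxValue μ τ z + ∑ a, (τ' a - τ a) *
        {z : Fin K → ℝ | threshold μ τ a z ≤ z a}.indicator (fun z => z a) z) ∂(gaussPi K))
      ≤ ∫ z, maxValue μ τ' z ∂(gaussPi K) := by
    refine integral_mono_ae ((integrable_maxValue (by omega) μ τ).add hsum)
      (integrable_maxValue (by omega) μ τ') ?_
    filter_upwards [ae_all_iff.mpr (ae_ne_threshold μ τ)] with z hz
    exact maxValue_add_sum_indicator_le (by omega) μ hτ τ' hz (nonempty_ne hK)
  rw [integral_add (integrable_maxValue (by omega) μ τ) hsum,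
    integral_finsetSum _ fun a _ => hint a] at h
  simpa only [integral_const_mul, integral_indicator_threshold_le] using h

theorem abs_threshold_le {K : ℕ} (hK : 2 ≤ K) {μ τ : Fin K → ℝ} {l u B : ℝ} (hl : 0 < l)
    (hτl : ∀ a, l ≤ τ a) (hτu : ∀ a, τ a ≤ u) (hB : ∀ a b, |μ b - μ a| ≤ B) (a : Fin K)
    (z : Fin K → ℝ) : |threshold μ τ a z| ≤ (B + u) / l * (1 + ∑ b, |z b|) := by
  have := nonempty_ne hK a
  have h := abs_ciSup_sub_ciSup_le (f := fun b : {b : Fin K // b ≠ a} =>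
    (μ b + τ b * z b - μ a) / τ a) (g := fun _ => 0) (C := (B + u) / l * (1 + ∑ b, |z b|))
    fun b => by
      have hzb : |z b| ≤ ∑ b, |z b| :=
        Finset.single_le_sum (f := fun b => |z b|) (fun _ _ => abs_nonneg _) (Finset.mem_univ _)
      have hS : 0 ≤ ∑ b, |z b| := Finset.sum_nonneg fun _ _ => abs_nonneg _
      have hB0 : 0 ≤ B := (abs_nonneg _).trans (hB a a)
      have hu0 : 0 < u := hl.trans_le ((hτl a).trans (hτu a))
      have hnum : |μ b + τ b * z b - μ a| ≤ (B + u) * (1 + ∑ b, |z b|) := by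
        have h₁ : |τ b * z b| ≤ u * ∑ b, |z b| := by
          rw [abs_mul, abs_of_pos (hl.trans_le (hτl b))]
          exact mul_le_mul (hτu b) hzb (abs_nonneg _) hu0.le
        calc |μ b + τ b * z b - μ a| = |(μ b - μ a) + τ b * z b| := by ring_nf
          _ ≤ |μ b - μ a| + |τ b * z b| := abs_add_le _ _
          _ ≤ B + u * ∑ b, |z b| := add_le_add (hB a b) h₁
          _ ≤ (B + u) * (1 + ∑ b, |z b|) := by nlinarith [mul_nonneg hB0 hS]
      rw [sub_zero, abs_div, abs_of_pos (hl.trans_le (hτl a)), div_mul_eq_mul_div]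
      exact div_le_div₀ (by positivity) hnum hl (hτl a)
  simpa [threshold] using h

theorem abs_threshold_sub_le {K : ℕ} (hK : 2 ≤ K) {μ τ τ' : Fin K → ℝ} {l u B : ℝ} (hl : 0 < l)
    (hτl : ∀ a, l ≤ τ a) (hτu : ∀ a, τ a ≤ u) (hτl' : ∀ a, l ≤ τ' a)
    (hB : ∀ a b, |μ b - μ a| ≤ B) (a : Fin K) (z : Fin K → ℝ) :
    |threshold μ τ a z - threshold μ τ' a z|
      ≤ (B + 2 * u) / l ^ 2 * (∑ b, |τ b - τ' b|) * (1 + ∑ b, |z b|) := by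
  have := nonempty_ne hK a
  refine abs_ciSup_sub_ciSup_le fun b => ?_
  have hzb : |z b| ≤ ∑ b, |z b| :=
    Finset.single_le_sum (f := fun b => |z b|) (fun _ _ => abs_nonneg _) (Finset.mem_univ _)
  have hD : ∀ c, |τ c - τ' c| ≤ ∑ b, |τ b - τ' b| := fun c =>
    Finset.single_le_sum (f := fun b => |τ b - τ' b|) (fun _ _ => abs_nonneg _)
      (Finset.mem_univ _)
  have hDa := hD a
  have hDb := hD b
  set S := ∑ b, |z b|
  set D := ∑ b, |τ b - τ' b|
  have hS : 0 ≤ S := (abs_nonneg _).trans hzb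
  have hD0 : 0 ≤ D := (abs_nonneg _).trans hDa
  have hB0 : 0 ≤ B := (abs_nonneg _).trans (hB a a)
  have hu0 : 0 < u := hl.trans_le ((hτl a).trans (hτu a))
  have hpa := hl.trans_le (hτl a)
  have hpa' := hl.trans_le (hτl' a)
  have heq : (μ b + τ b * z b - μ a) / τ a - (μ b + τ' b * z b - μ a) / τ' a
      = (τ a * ((τ b - τ' b) * z b) - (τ a - τ' a) * ((μ b - μ a) + τ b * z b))
        / (τ a * τ' a) := by
    field_simp
    ring
  have h₁ : |τ b * z b| ≤ u * S := by
    rw [abs_mul, abs_of_pos (hl.trans_le (hτl b))]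
    exact mul_le_mul (hτu b) hzb (abs_nonneg _) hu0.le
  have h₂ : |(μ b - μ a) + τ b * z b| ≤ B + u * S :=
    (abs_add_le _ _).trans (add_le_add (hB a b) h₁)
  have h₃ : |τ a * ((τ b - τ' b) * z b)| ≤ u * (D * S) := by
    rw [abs_mul, abs_mul, abs_of_pos hpa]
    gcongr
    exact hτu a
  have h₄ : |(τ a - τ' a) * ((μ b - μ a) + τ b * z b)| ≤ D * (B + u * S) := by
    rw [abs_mul]
    gcongr
  have hnum : |τ a * ((τ b - τ' b) * z b) - (τ a - τ' a) * ((μ b - μ a) + τ b * z b)|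
      ≤ (B + 2 * u) * D * (1 + S) := by
    refine (abs_sub _ _).trans ((add_le_add h₃ h₄).trans ?_)
    have := mul_nonneg (mul_nonneg hB0 hD0) hS
    have := mul_nonneg hu0.le hD0
    nlinarith
  rw [heq, abs_div, abs_of_pos (mul_pos hpa hpa')]
  calc _ ≤ (B + 2 * u) * D * (1 + S) / l ^ 2 := by
        refine div_le_div₀ (by positivity) hnum (by positivity) ?_
        rw [sq]
        exact mul_le_mul (hτl a) (hτl' a) hl.le hpa.le
    _ = _ := by ring

theorem meanDensity_lower_bound {K : ℕ} (hK : 2 ≤ K) {μ : Fin K → ℝ} {l u B : ℝ} (hl : 0 < l)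
    (hB : ∀ a b, |μ b - μ a| ≤ B) :
    ∃ c > 0, ∀ τ : Fin K → ℝ, (∀ a, l ≤ τ a) → (∀ a, τ a ≤ u) → ∀ a, c ≤ meanDensity μ τ a := by
  have hm : Measurable fun z : Fin K → ℝ => (B + u) / l * (1 + ∑ b, |z b|) := by fun_prop
  refine ⟨∫ z, gaussianPDFReal 0 1 ((B + u) / l * (1 + ∑ b, |z b|)) ∂(gaussPi K), ?_, ?_⟩
  · rw [gt_iff_lt, integral_pos_iff_support_of_nonneg
      (fun z => gaussianPDFReal_nonneg _ _ _) (integrable_gaussianPDFReal_comp hm)]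
    have : (Function.support fun z : Fin K → ℝ =>
        gaussianPDFReal 0 1 ((B + u) / l * (1 + ∑ b, |z b|))) = Set.univ :=
      Set.eq_univ_of_forall fun z => (gaussianPDFReal_pos _ _ _ one_ne_zero).ne'
    rw [this]
    simp
  · intro τ hτl hτu a
    exact integral_mono (integrable_gaussianPDFReal_comp hm)
      (integrable_gaussianPDFReal_comp (measurable_threshold μ τ a)) fun z =>
        gaussianPDFReal_zero_one_le_of_abs_le (abs_threshold_le hK hl hτl hτu hB a z)

theorem abs_meanDensity_sub_le {K : ℕ} (hK : 2 ≤ K) {μ τ τ' : Fin K → ℝ} {l u B : ℝ}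
    (hl : 0 < l) (hτl : ∀ a, l ≤ τ a) (hτu : ∀ a, τ a ≤ u) (hτl' : ∀ a, l ≤ τ' a)
    (hB : ∀ a b, |μ b - μ a| ≤ B) (a : Fin K) :
    |meanDensity μ τ a - meanDensity μ τ' a|
      ≤ (B + 2 * u) / l ^ 2 * (∫ z, (1 + ∑ b, |z b|) ∂(gaussPi K)) * ∑ b, |τ b - τ' b| := by
  unfold meanDensity
  rw [← integral_sub (integrable_gaussianPDFReal_comp (measurable_threshold μ τ a))
    (integrable_gaussianPDFReal_comp (measurable_threshold μ τ' a))]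
  have h := norm_integral_le_of_norm_le
    (f := fun z => gaussianPDFReal 0 1 (threshold μ τ a z)
      - gaussianPDFReal 0 1 (threshold μ τ' a z))
    ((integrable_one_add_sum_abs_gaussPi K).const_mul
      ((B + 2 * u) / l ^ 2 * (∑ b, |τ b - τ' b|)))
    (Filter.Eventually.of_forall fun z => by
      rw [Real.norm_eq_abs]
      exact (abs_gaussianPDFReal_zero_one_sub_le _ _).trans
        (abs_threshold_sub_le hK hl hτl hτu hτl' hB a z))
  rw [integral_const_mul, Real.norm_eq_abs] at h
  linarith

/-- Strong concavity of `r ↦ √(r / (r + β))` on `(0, 1]`. -/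
theorem sqrt_div_add_strongConcave {x y p q β : ℝ} (hx : 0 < x) (hy : 0 < y) (hx1 : x ≤ 1)
    (hy1 : y ≤ 1) (hp : 0 ≤ p) (hq : 0 ≤ q) (hpq : p + q = 1) (hβ : 0 < β) (hβ1 : β ≤ 1) :
    p * √(x / (x + β)) + q * √(y / (y + β)) + β / 16 * (p * q * (x - y) ^ 2)
      ≤ √((p * x + q * y) / (p * x + q * y + β)) := by
  obtain rfl : q = 1 - p := by linarith
  set w := p * x + (1 - p) * y with hw
  have hw0 : 0 < w := by
    rcases hp.eq_or_lt with h | h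
    · rw [hw, ← h]; simpa using hy
    · have := mul_pos h hx
      have := mul_nonneg hq hy.le
      linarith
  have hw1 : w ≤ 1 := by nlinarith
  have hratio : ∀ r, 0 < r → 0 ≤ r / (r + β) ∧ √(r / (r + β)) ≤ 1 := fun r hr =>
    ⟨by positivity, Real.sqrt_le_one.mpr ((div_le_one (by positivity)).mpr (by linarith))⟩
  have hXY : w / (w + β) - (p * (x / (x + β)) + (1 - p) * (y / (y + β)))
      = β * (p * (1 - p) * (x - y) ^ 2) / ((x + β) * (y + β) * (w + β)) := by
    have h₁ : x + β ≠ 0 := by positivity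
    have h₂ : y + β ≠ 0 := by positivity
    have h₃ : w + β ≠ 0 := by positivity
    field_simp
    rw [hw]
    ring
  have hgap : β / 8 * (p * (1 - p) * (x - y) ^ 2)
      ≤ w / (w + β) - (p * (x / (x + β)) + (1 - p) * (y / (y + β))) := by
    have hden : (x + β) * (y + β) * (w + β) ≤ 8 := by
      calc (x + β) * (y + β) * (w + β) ≤ 2 * 2 * 2 := by gcongr <;> linarith
        _ = 8 := by norm_num
    have hnum : 0 ≤ β * (p * (1 - p) * (x - y) ^ 2) := by positivity
    rw [hXY]
    calc _ = β * (p * (1 - p) * (x - y) ^ 2) / 8 := by ring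
      _ ≤ _ := div_le_div_of_nonneg_left hnum (by positivity) hden
  have hδ : 0 ≤ β / 8 * (p * (1 - p) * (x - y) ^ 2) := by positivity
  obtain ⟨hx0, hxs⟩ := hratio x hx
  obtain ⟨hy0, hys⟩ := hratio y hy
  obtain ⟨hz0, hzs⟩ := hratio w hw0
  have hxq := Real.sq_sqrt hx0
  have hyq := Real.sq_sqrt hy0
  have hzq := Real.sq_sqrt hz0
  rw [← hxq, ← hyq, ← hzq] at hgap
  have hR0 := Real.sqrt_nonneg (w / (w + β))
  have hS0 := Real.sqrt_nonneg (x / (x + β))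
  have hT0 := Real.sqrt_nonneg (y / (y + β))
  set S := √(x / (x + β))
  set T := √(y / (y + β))
  set R := √(w / (w + β))
  have hW : (p * S + (1 - p) * T) ^ 2 ≤ p * S ^ 2 + (1 - p) * T ^ 2 := by
    nlinarith [mul_nonneg (mul_nonneg hp hq) (sq_nonneg (S - T))]
  have hW0 : 0 ≤ p * S + (1 - p) * T := by positivity
  have hW1 : p * S + (1 - p) * T ≤ 1 := by nlinarith
  set W := p * S + (1 - p) * T
  have hWR : W ≤ R := (sq_le_sq₀ hW0 hR0).mp (by linarith)
  nlinarith [mul_nonneg (sub_nonneg.mpr hWR) (sub_nonneg.mpr hzs),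
    mul_nonneg (sub_nonneg.mpr hWR) (sub_nonneg.mpr hW1)]

theorem half_le_sqrt_div_add {x ε β : ℝ} (hε : 0 < ε) (hx : ε ≤ x) (hβ : 0 < β) (hβε : β ≤ ε) :
    1 / 2 ≤ √(x / (x + β)) := by
  refine Real.le_sqrt_of_sq_le ?_
  rw [le_div_iff₀ (by linarith)]
  linarith

theorem abs_sqrt_div_add_sub_le {x y ε β : ℝ} (hε : 0 < ε) (hx : ε ≤ x) (hy : ε ≤ y)
    (hβ : 0 < β) (hβε : β ≤ ε) :
    |√(x / (x + β)) - √(y / (y + β))| ≤ β / ε ^ 2 * |x - y| := by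
  have hx0 := hε.trans_le hx
  have hy0 := hε.trans_le hy
  have hsx := half_le_sqrt_div_add hε hx hβ hβε
  have hsy := half_le_sqrt_div_add hε hy hβ hβε
  have h₁ : (√(x / (x + β)) - √(y / (y + β))) * (√(x / (x + β)) + √(y / (y + β)))
      = β * (x - y) / ((x + β) * (y + β)) := by
    have : (√(x / (x + β)) - √(y / (y + β))) * (√(x / (x + β)) + √(y / (y + β)))
        = √(x / (x + β)) ^ 2 - √(y / (y + β)) ^ 2 := by ring
    rw [this, Real.sq_sqrt (by positivity), Real.sq_sqrt (by positivity)]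
    field_simp
    ring
  have h₂ : |√(x / (x + β)) - √(y / (y + β))| * (√(x / (x + β)) + √(y / (y + β)))
      = β * |x - y| / ((x + β) * (y + β)) := by
    rw [← abs_of_nonneg (a := √(x / (x + β)) + √(y / (y + β))) (by positivity), ← abs_mul, h₁,
      abs_div, abs_mul, abs_of_pos hβ, abs_of_pos (a := (x + β) * (y + β)) (by positivity)]
  calc |√(x / (x + β)) - √(y / (y + β))|
      ≤ |√(x / (x + β)) - √(y / (y + β))| * (√(x / (x + β)) + √(y / (y + β))) :=
        le_mul_of_one_le_right (abs_nonneg _) (by linarith)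
    _ = β * |x - y| / ((x + β) * (y + β)) := h₂
    _ ≤ β * |x - y| / ε ^ 2 := by
        refine div_le_div_of_nonneg_left (by positivity) (by positivity) ?_
        rw [sq]
        exact mul_le_mul (by linarith) (by linarith) hε.le (by linarith)
    _ = _ := by ring

theorem exists_pos_forall_le {ι : Type*} [Finite ι] {f : ι → ℝ} (hf : ∀ i, 0 < f i) :
    ∃ c > 0, ∀ i, c ≤ f i := by
  cases isEmpty_or_nonempty ι
  · exact ⟨1, one_pos, fun i => isEmptyElim i⟩
  · obtain ⟨i, hi⟩ := Finite.exists_min f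
    exact ⟨f i, hf i, hi⟩

/-- The posterior standard deviations entering `Vplan`. -/
noncomputable def planScale {K : ℕ} (σ s : Fin K → ℝ) (α : ℝ) (ρ : Fin K → ℝ) (a : Fin K) : ℝ :=
  σ a * √(ρ a / (ρ a + α * (s a ^ 2 / σ a ^ 2)))

theorem Vplan_eq_integral_maxValue {K : ℕ} (μ : Fin K → ℝ) {σ : Fin K → ℝ} (s : Fin K → ℝ)
    (hσ : ∀ a, 0 < σ a) (ρ : Fin K → ℝ) (α : ℝ) :
    Vplan K μ σ s ρ α = ∫ z, maxValue μ (planScale σ s α ρ) z ∂(gaussPi K) := by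
  unfold Vplan maxValue planScale
  congr 1
  ext z
  congr 1
  ext a
  have h : ρ a * σ a ^ 2 / (α * s a ^ 2 + ρ a * σ a ^ 2)
      = ρ a / (ρ a + α * (s a ^ 2 / σ a ^ 2)) := by
    have h₀ := (hσ a).ne'
    have h₁ : α * s a ^ 2 + ρ a * σ a ^ 2 = (ρ a + α * (s a ^ 2 / σ a ^ 2)) * σ a ^ 2 := by
      field_simp
      ring
    rw [h₁, mul_div_mul_right _ _ (pow_ne_zero 2 h₀)]
  rw [h]

/-- Concavity of the expected maximum along a chord, up to a quadratic error, with the gain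
obtained when the intermediate point is raised by at least `d`. -/
theorem integral_maxValue_chord_le {K : ℕ} (hK : 2 ≤ K) (μ : Fin K → ℝ) {τ τ' υ : Fin K → ℝ}
    {p q c L : ℝ} {d : Fin K → ℝ} (hp : 0 ≤ p) (hq : 0 ≤ q) (hpq : p + q = 1)
    (hτ : ∀ a, 0 < τ a) (hτ' : ∀ a, 0 < τ' a) (hd : ∀ a, 0 ≤ d a)
    (hυ : ∀ a, p * τ a + q * τ' a + d a ≤ υ a)
    (hc : 0 ≤ c) (hcm : ∀ a, c ≤ meanDensity μ (fun a => p * τ a + q * τ' a) a)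
    (hL : ∀ a, |meanDensity μ τ a - meanDensity μ τ' a| ≤ L * ∑ b, |τ b - τ' b|) :
    p * (∫ z, maxValue μ τ z ∂(gaussPi K)) + q * (∫ z, maxValue μ τ' z ∂(gaussPi K))
        + c * ∑ a, d a
      ≤ (∫ z, maxValue μ υ z ∂(gaussPi K)) + p * q * (L * (∑ a, |τ a - τ' a|) ^ 2) := by
  set w : Fin K → ℝ := fun a => p * τ a + q * τ' a with hw
  have hwpos : ∀ a, 0 < w a := fun a => (convex_Ioi (0 : ℝ)) (hτ a) (hτ' a) hp hq hpq
  have hmid := integral_maxValue_add_sum_meanDensity_le hK μ hwpos υ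
  have hleft := integral_maxValue_add_sum_meanDensity_le hK μ hτ w
  have hright := integral_maxValue_add_sum_meanDensity_le hK μ hτ' w
  have hgain : c * ∑ a, d a ≤ ∑ a, (υ a - w a) * meanDensity μ w a := by
    rw [Finset.mul_sum]
    refine Finset.sum_le_sum fun a _ => ?_
    rw [mul_comm]
    exact mul_le_mul (by linarith [hυ a]) (hcm a) hc (by linarith [hυ a, hd a])
  have hcross : p * ∑ a, (w a - τ a) * meanDensity μ τ a
      + q * ∑ a, (w a - τ' a) * meanDensity μ τ' a
      = -(p * q * ∑ a, (τ a - τ' a) * (meanDensity μ τ a - meanDensity μ τ' a)) := by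
    simp only [Finset.mul_sum, ← Finset.sum_add_distrib, ← Finset.sum_neg_distrib]
    refine Finset.sum_congr rfl fun a _ => ?_
    obtain rfl : q = 1 - p := by linarith
    simp only [hw]
    ring
  have hloss : ∑ a, (τ a - τ' a) * (meanDensity μ τ a - meanDensity μ τ' a)
      ≤ L * (∑ a, |τ a - τ' a|) ^ 2 := by
    calc _ ≤ ∑ a, |τ a - τ' a| * (L * ∑ b, |τ b - τ' b|) := by
          refine Finset.sum_le_sum fun a _ => ?_
          refine (le_abs_self _).trans ?_
          rw [abs_mul]
          exact mul_le_mul_of_nonneg_left (hL a) (abs_nonneg _)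
      _ = _ := by rw [← Finset.sum_mul]; ring
  have h₁ := mul_le_mul_of_nonneg_left hleft hp
  have h₂ := mul_le_mul_of_nonneg_left hright hq
  have h₃ := mul_le_mul_of_nonneg_left hloss (mul_nonneg hp hq)
  have h₄ : p * (∫ z, maxValue μ w z ∂(gaussPi K)) + q * (∫ z, maxValue μ w z ∂(gaussPi K))
      = ∫ z, maxValue μ w z ∂(gaussPi K) := by rw [← add_mul, hpq, one_mul]
  linarith

theorem convex_truncatedSimplex (K : ℕ) (ε : ℝ) :
    Convex ℝ {ρ : Fin K → ℝ | ((∀ a, 0 ≤ ρ a) ∧ ∑ a, ρ a = 1) ∧ ∀ a, ε ≤ ρ a} := by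
  have h₁ := convex_stdSimplex ℝ (Fin K)
  have h₂ : Convex ℝ {ρ : Fin K → ℝ | ∀ a, ε ≤ ρ a} := convex_Ici (fun _ : Fin K => ε)
  exact h₁.inter h₂

theorem planScale_bounds {K : ℕ} {σ s ρ : Fin K → ℝ} {α ε : ℝ} (hσ : ∀ a, 0 < σ a) (hε : 0 < ε)
    (hρ : ∀ a, ε ≤ ρ a) (hβ : ∀ a, 0 < α * (s a ^ 2 / σ a ^ 2))
    (hβε : ∀ a, α * (s a ^ 2 / σ a ^ 2) ≤ ε) (a : Fin K) :
    σ a / 2 ≤ planScale σ s α ρ a ∧ planScale σ s α ρ a ≤ σ a := by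
  unfold planScale
  have h₁ := half_le_sqrt_div_add hε (hρ a) (hβ a) (hβε a)
  have h₂ : √(ρ a / (ρ a + α * (s a ^ 2 / σ a ^ 2))) ≤ 1 :=
    Real.sqrt_le_one.mpr (div_le_one_of_le₀ (by linarith [hβ a])
      (by linarith [hβ a, hρ a]))
  have := hσ a
  constructor <;> nlinarith

/-- For every `0 < ε < 1/K` there exist `α₀ > 0` and `m > 0` such that
for all `α ∈ (0, α₀)`, the map `ρ ↦ α⁻¹ V(ρ, α)` is `m`-strongly concave on the
truncated simplex `Δ_K^ε`, i.e. `ρ ↦ α⁻¹ V(ρ, α) + (m/2)‖ρ‖²` is concave there. -/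
theorem stmt6 (K : ℕ) (hK : 2 ≤ K)
    (μ σ s : Fin K → ℝ) (hσ : ∀ a, 0 < σ a) (hs : ∀ a, 0 < s a) :
    ∀ ε : ℝ, 0 < ε → ε < 1 / (K : ℝ) →
      ∃ α₀ > (0 : ℝ), ∃ m > (0 : ℝ), ∀ α : ℝ, 0 < α → α < α₀ →
        ConcaveOn ℝ
          {ρ : Fin K → ℝ | ((∀ a, 0 ≤ ρ a) ∧ ∑ a, ρ a = 1) ∧ ∀ a, ε ≤ ρ a}
          (fun ρ => α⁻¹ * Vplan K μ σ s ρ α + m / 2 * ∑ a, (ρ a) ^ 2) := by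
  intro ε hε hεK
  have hε1 : ε ≤ 1 := hεK.le.trans (by
    rw [one_div]; exact inv_le_one_of_one_le₀ (by exact_mod_cast (by omega : 1 ≤ K)))
  obtain ⟨l₀, hl₀, hl₀σ⟩ := exists_pos_forall_le hσ
  set l := l₀ / 2 with hl
  have hlpos : 0 < l := by positivity
  have le_sum {f : Fin K → ℝ} (hf : ∀ a, 0 ≤ f a) (a : Fin K) : f a ≤ ∑ b, f b :=
    Finset.single_le_sum (fun b _ => hf b) (Finset.mem_univ a)
  set u := ∑ a, σ a
  have hσu : ∀ a, σ a ≤ u := le_sum fun a => (hσ a).le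
  set B := ∑ a, ∑ b, |μ b - μ a|
  have hB : ∀ a b, |μ b - μ a| ≤ B := fun a b =>
    (le_sum (f := fun b => |μ b - μ a|) (fun _ => abs_nonneg _) b).trans
      (le_sum (f := fun a => ∑ b, |μ b - μ a|)
        (fun _ => Finset.sum_nonneg fun _ _ => abs_nonneg _) a)
  obtain ⟨c, hc, hcm⟩ := meanDensity_lower_bound hK (u := u) hlpos hB
  have hκ : ∀ a, 0 < s a ^ 2 / σ a ^ 2 := fun a => div_pos (pow_pos (hs a) 2) (pow_pos (hσ a) 2)
  set κ := ∑ a, s a ^ 2 / σ a ^ 2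
  have hκle : ∀ a, s a ^ 2 / σ a ^ 2 ≤ κ := le_sum fun a => (hκ a).le
  have hκ0 : 0 ≤ κ := Finset.sum_nonneg fun a _ => (hκ a).le
  obtain ⟨k, hk, hkle⟩ := exists_pos_forall_le fun a => mul_pos (hσ a) (hκ a)
  set L := (B + 2 * u) / l ^ 2 * (∫ z, (1 + ∑ b, |z b|) ∂(gaussPi K))
  have hu0 : 0 ≤ u := Finset.sum_nonneg fun a _ => (hσ a).le
  have hB0 : 0 ≤ B := Finset.sum_nonneg fun a _ => Finset.sum_nonneg fun b _ => abs_nonneg _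
  have hL0 : 0 ≤ L := mul_nonneg (by positivity)
    (integral_nonneg fun z => by positivity)
  set C := u * κ / ε ^ 2
  have hC0 : 0 ≤ C := by positivity
  set Q := L * (C ^ 2 * K)
  have hQ0 : 0 ≤ Q := by positivity
  set m := c * k / 16
  have hm0 : 0 < m := by positivity
  refine ⟨min (ε / (κ + 1)) (m / (2 * (Q + 1))), by positivity, m, hm0, fun α hα hα₀ => ?_⟩
  have hα₁ : α * (κ + 1) < ε := (lt_div_iff₀ (by positivity)).mp (hα₀.trans_le (min_le_left _ _))
  have hα₂ : α * (2 * (Q + 1)) < m :=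
    (lt_div_iff₀ (by positivity)).mp (hα₀.trans_le (min_le_right _ _))
  have hβ : ∀ a, 0 < α * (s a ^ 2 / σ a ^ 2) := fun a => mul_pos hα (hκ a)
  have hβε : ∀ a, α * (s a ^ 2 / σ a ^ 2) ≤ ε := fun a => by
    have := mul_le_mul_of_nonneg_left (hκle a) hα.le
    linarith
  refine ⟨convex_truncatedSimplex K ε, ?_⟩
  rintro x ⟨⟨hx0, hx1⟩, hxε⟩ y ⟨⟨hy0, hy1⟩, hyε⟩ p q hp hq hpq
  have hxle : ∀ a, x a ≤ 1 := fun a => (le_sum hx0 a).trans hx1.le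
  have hyle : ∀ a, y a ≤ 1 := fun a => (le_sum hy0 a).trans hy1.le
  have hTx := planScale_bounds hσ hε hxε hβ hβε
  have hTy := planScale_bounds hσ hε hyε hβ hβε
  have hlx : ∀ a, l ≤ planScale σ s α x a := fun a => by linarith [(hTx a).1, hl₀σ a]
  have hly : ∀ a, l ≤ planScale σ s α y a := fun a => by linarith [(hTy a).1, hl₀σ a]
  have hux : ∀ a, planScale σ s α x a ≤ u := fun a => (hTx a).2.trans (hσu a)
  have huy : ∀ a, planScale σ s α y a ≤ u := fun a => (hTy a).2.trans (hσu a)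
  set D := ∑ a, (x a - y a) ^ 2
  have hD0 : 0 ≤ D := Finset.sum_nonneg fun _ _ => sq_nonneg _
  have hchord := integral_maxValue_chord_le hK μ (υ := planScale σ s α (p • x + q • y))
    (d := fun a => α * k / 16 * (p * q * (x a - y a) ^ 2)) (c := c) (L := L) hp hq hpq
    (fun a => hlpos.trans_le (hlx a)) (fun a => hlpos.trans_le (hly a))
    (fun a => by positivity)
    (fun a => by
      have h := mul_le_mul_of_nonneg_left (sqrt_div_add_strongConcave (hε.trans_le (hxε a))
        (hε.trans_le (hyε a)) (hxle a) (hyle a) hp hq hpq (hβ a) ((hβε a).trans hε1)) (hσ a).le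
      have h' : α * k / 16 * (p * q * (x a - y a) ^ 2)
          ≤ α * (σ a * (s a ^ 2 / σ a ^ 2)) / 16 * (p * q * (x a - y a) ^ 2) := by
        have := hkle a
        gcongr
      simp only [planScale, Pi.add_apply, Pi.smul_apply, smul_eq_mul]
      linarith)
    hc.le
    (hcm _ (fun a => convex_Ici l (hlx a) (hly a) hp hq hpq)
      (fun a => convex_Iic u (hux a) (huy a) hp hq hpq))
    (abs_meanDensity_sub_le hK hlpos hlx hux hly hB)
  have hdiff : ∑ a, |planScale σ s α x a - planScale σ s α y a| ≤ α * C * ∑ a, |x a - y a| := by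
    rw [Finset.mul_sum]
    refine Finset.sum_le_sum fun a _ => ?_
    unfold planScale
    rw [← mul_sub, abs_mul, abs_of_pos (hσ a)]
    calc _ ≤ σ a * (α * (s a ^ 2 / σ a ^ 2) / ε ^ 2 * |x a - y a|) :=
          mul_le_mul_of_nonneg_left (abs_sqrt_div_add_sub_le hε (hxε a) (hyε a) (hβ a) (hβε a))
            (hσ a).le
      _ ≤ u * (α * κ / ε ^ 2 * |x a - y a|) := by
          have := hσu a
          have := hκle a
          gcongr
      _ = α * C * |x a - y a| := by ring
  have hCS : (∑ a, |x a - y a|) ^ 2 ≤ K * D := by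
    have h := sq_sum_le_card_mul_sum_sq (s := Finset.univ) (f := fun a : Fin K => |x a - y a|)
    simpa using h
  have hquad : L * (∑ a, |planScale σ s α x a - planScale σ s α y a|) ^ 2 ≤ α ^ 2 * Q * D := by
    calc _ ≤ L * (α * C * ∑ a, |x a - y a|) ^ 2 := by gcongr
      _ = L * (α ^ 2 * C ^ 2) * (∑ a, |x a - y a|) ^ 2 := by ring
      _ ≤ L * (α ^ 2 * C ^ 2) * (K * D) := by gcongr
      _ = _ := by ring
  have hsq : p * ∑ a, x a ^ 2 + q * ∑ a, y a ^ 2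
      = ∑ a, (p • x + q • y) a ^ 2 + p * q * D := by
    obtain rfl : q = 1 - p := by linarith
    simp only [D, Finset.mul_sum, ← Finset.sum_add_distrib]
    refine Finset.sum_congr rfl fun a _ => ?_
    simp only [Pi.add_apply, Pi.smul_apply, smul_eq_mul]
    ring
  simp only [Vplan_eq_integral_maxValue μ s hσ, smul_eq_mul]
  have hgain : c * ∑ a, α * k / 16 * (p * q * (x a - y a) ^ 2) = α * (m * (p * q * D)) := by
    rw [← Finset.mul_sum, ← Finset.mul_sum]
    ring
  rw [hgain] at hchord
  set X := ∫ z, maxValue μ (planScale σ s α x) z ∂(gaussPi K)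
  set Y := ∫ z, maxValue μ (planScale σ s α y) z ∂(gaussPi K)
  set Z := ∫ z, maxValue μ (planScale σ s α (p • x + q • y)) z ∂(gaussPi K)
  have hpqD : 0 ≤ p * q * D := by positivity
  have hscaled : p * X + q * Y ≤ Z + α * (-(m / 2) * (p * q * D)) := by
    have h₁ := mul_le_mul_of_nonneg_left hquad (mul_nonneg hp hq)
    have h₂ : α * Q ≤ m / 2 := by nlinarith
    have h₃ := mul_le_mul_of_nonneg_left (mul_le_mul_of_nonneg_right h₂ hpqD) hα.le
    linarith
  have hdiv := mul_le_mul_of_nonneg_left hscaled (inv_pos.mpr hα).le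
  rw [mul_add _ Z, ← mul_assoc α⁻¹ α, inv_mul_cancel₀ hα.ne', one_mul] at hdiv
  have hsq' := congrArg (fun t => m / 2 * t) hsq
  linarith
end

section
/- Fix an arm a and hold μ_{a'} for a' ≠ a and all σ fixed. The map μ_a ↦ P(θ_a > max_{a'≠a} θ_{a'}) is differentiable on ℝ, and its derivative equals E[(1/σ_a) · φ((θ_a* − μ_a)/σ_a)]; that is, ∂/∂μ_a π_a^{TS}(μ, σ) = E[(1/σ_a) · φ((θ_a* − μ_a)/σ_a)], where π_a^{TS}(μ, σ) = P(θ_a > max_{a'≠a} θ_{a'}). -/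
open MeasureTheory ProbabilityTheory

/-- Separating one coordinate from the others turns a product of probability measures into a
binary product. -/
theorem measurePreserving_pi_separate {ι : Type*} [Fintype ι] [DecidableEq ι] {X : Type*} [MeasurableSpace X]
    (m : ι → Measure X) [∀ i, IsProbabilityMeasure (m i)] (a : ι) :
    MeasurePreserving (fun θ : ι → X => (fun b : {b // b ≠ a} => θ b.1, θ a))
      (Measure.pi m) ((Measure.pi fun b : {b // b ≠ a} => m b.1).prod (m a)) := by
  have h := measurePreserving_piEquivPiSubtypeProd m (fun b => b ≠ a)
  have h2 : MeasurePreserving (Function.eval (⟨a, not_not.mpr rfl⟩ : {b // ¬ b ≠ a}))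
      (Measure.pi fun b : {b // ¬ b ≠ a} => m b.1) (m a) :=
    measurePreserving_eval (fun b : {b // ¬ b ≠ a} => m b.1) ⟨a, not_not.mpr rfl⟩
  exact ((MeasurePreserving.id _).prod h2).comp h

theorem gaussianPDFReal_eq_stdNormalPDF {s : ℝ} (hs : 0 < s) (m t : ℝ) :
    gaussianPDFReal m (Real.toNNReal (s ^ 2)) t = (1 / s) * stdNormalPDF ((t - m) / s) := by
  have h : ((Real.toNNReal (s ^ 2) : NNReal) : ℝ) = s ^ 2 := Real.coe_toNNReal _ (by positivity)
  rw [gaussianPDFReal, stdNormalPDF, h, Real.sqrt_mul (by positivity), Real.sqrt_sq hs.le,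
    mul_inv, ← mul_assoc]
  congr 1
  · field_simp
  · congr 1
    field_simp

/-- The derivative of a Gaussian tail probability with respect to the mean is the density. -/
theorem hasDerivAt_gaussianReal_Ioi {v : NNReal} (hv : v ≠ 0) (t x : ℝ) :
    HasDerivAt (fun m => (gaussianReal m v).real (Set.Ioi t)) (gaussianPDFReal x v t) x := by
  have hc : Continuous (gaussianPDFReal 0 v) := by
    unfold gaussianPDFReal
    fun_prop
  have hi := integrable_gaussianPDFReal 0 v
  have key : ∀ m, (gaussianReal m v).real (Set.Ioi t) =
      (∫ u in Set.Ioi 0, gaussianPDFReal 0 v u) - ∫ u in (0 : ℝ)..(t - m),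
        gaussianPDFReal 0 v u := by
    intro m
    have h1 : gaussianReal m v = (gaussianReal 0 v).map (· + m) := by
      rw [gaussianReal_map_add_const, zero_add]
    have h2 : (fun u : ℝ => u + m) ⁻¹' Set.Ioi t = Set.Ioi (t - m) := by
      ext u
      simp [sub_lt_iff_lt_add]
    rw [h1, map_measureReal_apply (by fun_prop) measurableSet_Ioi, h2, measureReal_def,
      gaussianReal_apply_eq_integral _ hv,
      ENNReal.toReal_ofReal (integral_nonneg fun u => gaussianPDFReal_nonneg _ _ _),
      ← intervalIntegral.integral_Ioi_sub_Ioi' hi.integrableOn hi.integrableOn, sub_sub_cancel]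
  rw [funext key]
  have h3 : HasDerivAt (fun w => ∫ u in (0 : ℝ)..w, gaussianPDFReal 0 v u)
      (gaussianPDFReal 0 v (t - x)) (t - x) :=
    hc.integral_hasStrictDerivAt 0 (t - x) |>.hasDerivAt
  have h4 := (h3.comp x ((hasDerivAt_id x).const_sub t)).const_sub
    (∫ u in Set.Ioi 0, gaussianPDFReal 0 v u)
  refine h4.congr_deriv ?_
  simp [gaussianPDFReal]

theorem gaussianPDFReal_le (m : ℝ) (v : NNReal) (t : ℝ) :
    gaussianPDFReal m v t ≤ (Real.sqrt (2 * Real.pi * v))⁻¹ := by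
  refine mul_le_of_le_one_right (by positivity) (Real.exp_le_one_iff.mpr ?_)
  exact div_nonpos_of_nonpos_of_nonneg (neg_nonpos.mpr (sq_nonneg _)) (by positivity)

/-- The tail probability of a Gaussian at an independent random level can be differentiated in
the mean under the expectation. -/
theorem hasDerivAt_integral_gaussianReal_Ioi {Ω : Type*} [MeasurableSpace Ω] (ν : Measure Ω)
    [IsProbabilityMeasure ν] {M : Ω → ℝ} (hM : Measurable M) {v : NNReal} (hv : v ≠ 0) (x : ℝ) :
    HasDerivAt (fun m => ∫ ω, (gaussianReal m v).real (Set.Ioi (M ω)) ∂ν)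
      (∫ ω, gaussianPDFReal x v (M ω) ∂ν) x := by
  have hmeas : ∀ m, Measurable fun ω => (gaussianReal m v).real (Set.Ioi (M ω)) := by
    intro m
    have : Antitone fun t : ℝ => (gaussianReal m v).real (Set.Ioi t) :=
      fun s t hst => measureReal_mono (Set.Ioi_subset_Ioi hst)
    exact this.measurable.comp hM
  refine (hasDerivAt_integral_of_dominated_loc_of_deriv_le (s := Set.univ)
    (bound := fun _ => (Real.sqrt (2 * Real.pi * v))⁻¹)
    (F' := fun m ω => gaussianPDFReal m v (M ω)) Filter.univ_mem
    (Filter.Eventually.of_forall fun m => (hmeas m).aestronglyMeasurable)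
    ?_ ?_ ?_ (integrable_const _) ?_).2
  · refine Integrable.of_bound (hmeas x).aestronglyMeasurable 1 (ae_of_all _ fun ω => ?_)
    rw [Real.norm_of_nonneg measureReal_nonneg]
    exact measureReal_le_one
  · exact ((measurable_gaussianPDFReal x v).comp hM).aestronglyMeasurable
  · refine ae_of_all _ fun ω m _ => ?_
    rw [Real.norm_of_nonneg (gaussianPDFReal_nonneg _ _ _)]
    exact gaussianPDFReal_le _ _ _
  · exact ae_of_all _ fun ω m _ => hasDerivAt_gaussianReal_Ioi hv (M ω) m

/-- For independent `θ_a ~ N(μ_a, σ_a²)` and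
`θ_a* = max_{a'≠a} θ_{a'}`, the map `μ_a ↦ π_a^{TS}(μ, σ) = P(θ_a > max_{a'≠a} θ_{a'})`
(with `μ_{a'}`, `a' ≠ a`, and `σ` held fixed) is differentiable on `ℝ` with derivative
`E[(1/σ_a) φ((θ_a* − μ_a)/σ_a)]`. -/
theorem stmt9 (K : ℕ) (hK : 2 ≤ K)
    (μ σ : Fin K → ℝ) (hσ : ∀ a, 0 < σ a) (a : Fin K) :
    ∀ x : ℝ,
      HasDerivAt
        (fun m : ℝ =>
          ((Measure.pi fun a' =>
              gaussianReal (Function.update μ a m a') (Real.toNNReal ((σ a') ^ 2)))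
            {θ : Fin K → ℝ | (⨆ a' : {b : Fin K // b ≠ a}, θ a'.1) < θ a}).toReal)
        (∫ θ : Fin K → ℝ,
            (1 / σ a) * stdNormalPDF
              (((⨆ a' : {b : Fin K // b ≠ a}, θ a'.1) - x) / σ a)
          ∂(Measure.pi fun a' => gaussianReal (μ a') (Real.toNNReal ((σ a') ^ 2))))
        x := by
  intro x
  set v : Fin K → NNReal := fun b => Real.toNNReal ((σ b) ^ 2) with hv_def
  have hv : v a ≠ 0 := (Real.toNNReal_pos.mpr (pow_pos (hσ a) 2)).ne'
  set ν := Measure.pi fun b : {b : Fin K // b ≠ a} => gaussianReal (μ b.1) (v b.1) with hν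
  have hM : Measurable fun y : {b : Fin K // b ≠ a} → ℝ => ⨆ b, y b :=
    Measurable.iSup fun b => measurable_pi_apply b
  convert hasDerivAt_integral_gaussianReal_Ioi ν hM hv x using 1
  · funext m
    have hsep := measurePreserving_pi_separate
      (fun b => gaussianReal (Function.update μ a m b) (v b)) a
    have hrest : (fun b : {b : Fin K // b ≠ a} =>
        gaussianReal (Function.update μ a m b.1) (v b.1)) =
        fun b => gaussianReal (μ b.1) (v b.1) := by
      funext b
      rw [Function.update_of_ne b.2]
    rw [hrest, ← hν, Function.update_self] at hsep
    have hS : MeasurableSet {p : ({b : Fin K // b ≠ a} → ℝ) × ℝ | (⨆ b, p.1 b) < p.2} :=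
      measurableSet_lt (hM.comp measurable_fst) measurable_snd
    have h := hsep.measure_preimage hS.nullMeasurableSet
    rw [Measure.prod_apply hS] at h
    refine (congrArg ENNReal.toReal h).trans ?_
    rw [← integral_toReal (measurable_measure_prodMk_left hS).aemeasurable
      (ae_of_all _ fun _ => measure_lt_top _ _)]
    rfl
  · have hsep := measurePreserving_pi_separate (fun b => gaussianReal (μ b) (v b)) a
    have hfst := measurePreserving_fst.comp hsep
    rw [← hν] at hfst
    simp_rw [← gaussianPDFReal_eq_stdNormalPDF (hσ a)]
    have hf := ((measurable_gaussianPDFReal x (v a)).comp hM).aestronglyMeasurable (μ := ν)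
    rw [← hfst.map_eq] at hf ⊢
    exact (integral_map hfst.measurable.aemeasurable hf).symm
end

section
/- For any μ_a, μ_1 ∈ ℝ and σ_a, σ_1 > 0, ∫_{μ_1}^{∞} (1/σ_a) φ((x − μ_a)/σ_a) · (1/σ_1) φ((x − μ_1)/σ_1) dx = [exp(−(μ_a − μ_1)² / (2(σ_a² + σ_1²))) / sqrt(2π (σ_a² + σ_1²))] · (1 − Φ((σ_1/σ_a) · (μ_1 − μ_a) / sqrt(σ_a² + σ_1²))). -/
open MeasureTheory

/-- Standard normal CDF `Φ`. -/
noncomputable def stdNormalCDF (x : ℝ) : ℝ :=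
  ∫ t in Set.Iic x, stdNormalPDF t

lemma stdNormalPDF_eq_gaussianPDFReal_s11 :
    stdNormalPDF = ProbabilityTheory.gaussianPDFReal 0 1 := by
  ext x
  simp [stdNormalPDF, ProbabilityTheory.gaussianPDFReal]

lemma integrable_stdNormalPDF : Integrable stdNormalPDF := by
  rw [stdNormalPDF_eq_gaussianPDFReal_s11]
  exact ProbabilityTheory.integrable_gaussianPDFReal 0 1

lemma integral_stdNormalPDF : ∫ x, stdNormalPDF x = 1 := by
  rw [stdNormalPDF_eq_gaussianPDFReal_s11]
  exact ProbabilityTheory.integral_gaussianPDFReal_eq_one 0 one_ne_zero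

lemma integral_Ioi_stdNormalPDF (a : ℝ) :
    ∫ x in Set.Ioi a, stdNormalPDF x = 1 - stdNormalCDF a := by
  have h := integral_add_compl (measurableSet_Iic (a := a)) integrable_stdNormalPDF
  rw [Set.compl_Iic, integral_stdNormalPDF] at h
  rw [stdNormalCDF]
  linarith

lemma setIntegral_Ioi_comp_add_right (f : ℝ → ℝ) (a d : ℝ) :
    ∫ x in Set.Ioi a, f (x + d) = ∫ x in Set.Ioi (a + d), f x := by
  have h := (measurePreserving_add_right volume d).setIntegral_preimage_emb
    (measurableEmbedding_addRight d) f (Set.Ioi (a + d))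
  simpa using h

/-- Tail integral of a normal density written in terms of an affine change of variable. -/
lemma integral_Ici_stdNormalPDF_affine (a b : ℝ) {c : ℝ} (hc : 0 < c) :
    ∫ x in Set.Ici a, c * stdNormalPDF (c * (x - a) + b) = 1 - stdNormalCDF b := by
  have h := integral_comp_mul_left_Ioi (fun y ↦ stdNormalPDF (y + (b - c * a))) a hc
  rw [setIntegral_Ioi_comp_add_right, add_sub_cancel, integral_Ioi_stdNormalPDF] at h
  have h' : ∀ x, c * (x - a) + b = c * x + (b - c * a) := fun x ↦ by ring
  simp_rw [integral_Ici_eq_integral_Ioi, integral_const_mul, h']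
  rw [h, smul_eq_mul, mul_inv_cancel_left₀ hc.ne']

/-- The product of two normal densities is a multiple of a normal density. -/
lemma mul_stdNormalPDF_eq (μa μ1 x : ℝ) {σa σ1 : ℝ} (hσa : 0 < σa) (hσ1 : 0 < σ1) :
    (1 / σa) * stdNormalPDF ((x - μa) / σa) * ((1 / σ1) * stdNormalPDF ((x - μ1) / σ1))
      = Real.exp (-(μa - μ1) ^ 2 / (2 * (σa ^ 2 + σ1 ^ 2)))
          / Real.sqrt (2 * Real.pi * (σa ^ 2 + σ1 ^ 2))
        * (Real.sqrt (σa ^ 2 + σ1 ^ 2) / (σa * σ1)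
          * stdNormalPDF (Real.sqrt (σa ^ 2 + σ1 ^ 2) / (σa * σ1) * (x - μ1)
            + (σ1 / σa) * (μ1 - μa) / Real.sqrt (σa ^ 2 + σ1 ^ 2))) := by
  have hv : 0 < σa ^ 2 + σ1 ^ 2 := by positivity
  rw [Real.sqrt_mul (by positivity)]
  have hs2 := Real.sq_sqrt hv.le
  have hs := Real.sqrt_pos.2 hv
  set s := Real.sqrt (σa ^ 2 + σ1 ^ 2)
  have hp : 0 < Real.sqrt (2 * Real.pi) := by positivity
  have hexp : Real.exp (-((x - μa) / σa) ^ 2 / 2) * Real.exp (-((x - μ1) / σ1) ^ 2 / 2)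
      = Real.exp (-(μa - μ1) ^ 2 / (2 * s ^ 2))
        * Real.exp (-(s / (σa * σ1) * (x - μ1) + (σ1 / σa) * (μ1 - μa) / s) ^ 2 / 2) := by
    rw [← Real.exp_add, ← Real.exp_add]
    congr 1
    have hσ : σ1 ^ 2 = s ^ 2 - σa ^ 2 := by linarith
    field_simp
    have h4 : σ1 ^ 4 = (s ^ 2 - σa ^ 2) ^ 2 := by rw [← hσ]; ring
    ring_nf
    simp only [h4, hσ]
    ring
  rw [← hs2]
  unfold stdNormalPDF
  calc _ = (1 / (σa * σ1)) * (Real.sqrt (2 * Real.pi))⁻¹ ^ 2 *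
        (Real.exp (-((x - μa) / σa) ^ 2 / 2) * Real.exp (-((x - μ1) / σ1) ^ 2 / 2)) := by
        field_simp
    _ = _ := by
        rw [hexp]
        field_simp

/-- Gaussian product integral over a half line:
`∫_{μ₁}^{∞} (1/σ_a) φ((x−μ_a)/σ_a) (1/σ₁) φ((x−μ₁)/σ₁) dx
  = e^{−(μ_a−μ₁)²/(2(σ_a²+σ₁²))}/sqrt(2π(σ_a²+σ₁²)) ·
    (1 − Φ((σ₁/σ_a)(μ₁−μ_a)/sqrt(σ_a²+σ₁²)))`. -/
theorem stmt11 (μa μ1 σa σ1 : ℝ) (hσa : 0 < σa) (hσ1 : 0 < σ1) :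
    (∫ x in Set.Ici μ1,
        (1 / σa) * stdNormalPDF ((x - μa) / σa) * ((1 / σ1) * stdNormalPDF ((x - μ1) / σ1)))
      = Real.exp (-(μa - μ1) ^ 2 / (2 * (σa ^ 2 + σ1 ^ 2)))
          / Real.sqrt (2 * Real.pi * (σa ^ 2 + σ1 ^ 2))
        * (1 - stdNormalCDF ((σ1 / σa) * (μ1 - μa) / Real.sqrt (σa ^ 2 + σ1 ^ 2))) := by
  simp_rw [mul_stdNormalPDF_eq μa μ1 _ hσa hσ1]
  rw [integral_const_mul, integral_Ici_stdNormalPDF_affine _ _ (by positivity)]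
end

section
/- For every arm a, E[(1/σ_a) · φ((θ_a* − μ_a)/σ_a)] ≤ (K − 1) · max_{a'≠a} { (2π(σ_a² + σ_{a'}²))^{−1/2} · exp(−(μ_{a'} − μ_a)² / (2(σ_a² + σ_{a'}²))) }. -/
open MeasureTheory ProbabilityTheory

open scoped NNReal

theorem inv_mul_stdNormalPDF_eq_gaussianPDFReal {s : ℝ} (hs : 0 < s) (m x : ℝ) :
    (1 / s) * stdNormalPDF ((x - m) / s) = gaussianPDFReal m (Real.toNNReal (s ^ 2)) x := by
  have hs2 : ((Real.toNNReal (s ^ 2) : ℝ≥0) : ℝ) = s ^ 2 := Real.coe_toNNReal _ (sq_nonneg s)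
  rw [gaussianPDFReal, stdNormalPDF, hs2, Real.sqrt_mul (by positivity) (s ^ 2),
    Real.sqrt_sq hs.le, ← mul_assoc]
  congr 1
  · field_simp
  · congr 1
    field_simp

/-- Completing the square: a product of two Gaussian densities is a multiple of a third one. -/
theorem gaussianPDFReal_mul_gaussianPDFReal {v w : ℝ≥0} (hv : 0 < v) (hw : 0 < w) (m n x : ℝ) :
    gaussianPDFReal m v x * gaussianPDFReal n w x =
      gaussianPDFReal m (v + w) n *
        gaussianPDFReal ((m * w + n * v) / (v + w)) (v * w / (v + w)) x := by
  have hv' : (0 : ℝ) < v := hv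
  have hw' : (0 : ℝ) < w := hw
  simp only [gaussianPDFReal, NNReal.coe_add, NNReal.coe_mul, NNReal.coe_div]
  rw [mul_mul_mul_comm, mul_mul_mul_comm (Real.sqrt (2 * Real.pi * (v + w)))⁻¹, ← Real.exp_add, 
    ← Real.exp_add, ← mul_inv, ← mul_inv,
    ← Real.sqrt_mul (by positivity), ← Real.sqrt_mul (by positivity)]
  congr 1
  · congr 2
    field_simp
  · congr 1
    field_simp
    ring

theorem integral_gaussianPDFReal_gaussianReal {v w : ℝ≥0} (hv : 0 < v) (hw : 0 < w) (m n : ℝ) :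
    ∫ x, gaussianPDFReal m v x ∂(gaussianReal n w) = gaussianPDFReal m (v + w) n := by
  rw [integral_gaussianReal_eq_integral_smul hw.ne']
  simp_rw [smul_eq_mul, mul_comm (gaussianPDFReal n w _),
    gaussianPDFReal_mul_gaussianPDFReal hv hw]
  rw [integral_const_mul, integral_gaussianPDFReal_eq_one _ (by positivity), mul_one]

theorem integrable_gaussianPDFReal_of_isFiniteMeasure (m : ℝ) (v : ℝ≥0) (ν : Measure ℝ)
    [IsFiniteMeasure ν] : Integrable (gaussianPDFReal m v) ν := by
  refine Integrable.of_bound (measurable_gaussianPDFReal m v).aestronglyMeasurable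
    (Real.sqrt (2 * Real.pi * v))⁻¹ (Filter.Eventually.of_forall fun x => ?_)
  rw [Real.norm_of_nonneg (gaussianPDFReal_nonneg m v x), gaussianPDFReal]
  refine mul_le_of_le_one_right (by positivity) (Real.exp_le_one_iff.mpr ?_)
  rw [neg_div]
  exact neg_nonpos.mpr (by positivity)

/-- For independent `θ_a ~ N(μ_a, σ_a²)` and
`θ_a* = max_{a'≠a} θ_{a'}`,
`E[(1/σ_a) φ((θ_a* − μ_a)/σ_a)]
  ≤ (K−1) max_{a'≠a} (2π(σ_a²+σ_{a'}²))^{−1/2} e^{−(μ_{a'}−μ_a)²/(2(σ_a²+σ_{a'}²))}`. -/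
theorem stmt12 (K : ℕ) (hK : 2 ≤ K)
    (μ σ : Fin K → ℝ) (hσ : ∀ a, 0 < σ a) :
    ∀ a : Fin K,
      (∫ θ : Fin K → ℝ,
          (1 / σ a) * stdNormalPDF
            (((⨆ a' : {b : Fin K // b ≠ a}, θ a'.1) - μ a) / σ a)
        ∂(Measure.pi fun a' => gaussianReal (μ a') (Real.toNNReal ((σ a') ^ 2))))
      ≤ ((K : ℝ) - 1) *
          ⨆ a' : {b : Fin K // b ≠ a},
            (Real.sqrt (2 * Real.pi * ((σ a) ^ 2 + (σ a'.1) ^ 2)))⁻¹ *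
              Real.exp (-(μ a'.1 - μ a) ^ 2 / (2 * ((σ a) ^ 2 + (σ a'.1) ^ 2))) := by
  intro a
  have : Nontrivial (Fin K) := Fin.nontrivial_iff_two_le.mpr hK
  obtain ⟨b, hb⟩ := exists_ne a
  have : Nonempty {b : Fin K // b ≠ a} := ⟨⟨b, hb⟩⟩
  have hpos : ∀ c, 0 < Real.toNNReal ((σ c) ^ 2) := fun c =>
    Real.toNNReal_pos.mpr (pow_pos (hσ c) 2)
  set P := Measure.pi fun c => gaussianReal (μ c) (Real.toNNReal ((σ c) ^ 2))
  set f := gaussianPDFReal (μ a) (Real.toNNReal ((σ a) ^ 2))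
  have hmp : ∀ c : Fin K, MeasurePreserving (Function.eval c) P
      (gaussianReal (μ c) (Real.toNNReal ((σ c) ^ 2))) := fun c => measurePreserving_eval _ c
  have hint : ∀ c : Fin K, Integrable (fun θ : Fin K → ℝ => f (θ c)) P := fun c =>
    (hmp c).integrable_comp_of_integrable (integrable_gaussianPDFReal_of_isFiniteMeasure _ _ _)
  have hval : ∀ c : Fin K, ∫ θ, f (θ c) ∂P =
      (Real.sqrt (2 * Real.pi * ((σ a) ^ 2 + (σ c) ^ 2)))⁻¹ *
        Real.exp (-(μ c - μ a) ^ 2 / (2 * ((σ a) ^ 2 + (σ c) ^ 2))) := by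
    intro c
    have h := integral_map (hmp c).measurable.aemeasurable (μ := P) (f := f)
      (measurable_gaussianPDFReal _ _).aestronglyMeasurable
    rw [(hmp c).map_eq, integral_gaussianPDFReal_gaussianReal (hpos a) (hpos c)] at h
    refine h.symm.trans ?_
    rw [gaussianPDFReal, NNReal.coe_add, Real.coe_toNNReal _ (sq_nonneg _),
      Real.coe_toNNReal _ (sq_nonneg _)]
  simp_rw [inv_mul_stdNormalPDF_eq_gaussianPDFReal (hσ a)]
  have hcard : (Fintype.card {b : Fin K // b ≠ a} : ℝ) = (K : ℝ) - 1 := by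
    rw [Fintype.card_subtype_compl, Fintype.card_fin, Fintype.card_subtype_eq,
      Nat.cast_sub (by omega), Nat.cast_one]
  calc _ ≤ ∫ θ : Fin K → ℝ, ∑ c : {b : Fin K // b ≠ a}, f (θ c.1) ∂P := by
        refine integral_mono_of_nonneg
          (Filter.Eventually.of_forall fun θ => gaussianPDFReal_nonneg _ _ _)
          (integrable_finsetSum _ fun c _ => hint c.1)
          (Filter.Eventually.of_forall fun θ => ?_)
        obtain ⟨c, hc⟩ := exists_eq_ciSup_of_finite (f := fun c : {b : Fin K // b ≠ a} => θ c.1)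
        dsimp only
        rw [← hc]
        exact Finset.single_le_sum (f := fun c : {b : Fin K // b ≠ a} => f (θ c.1))
          (fun d _ => gaussianPDFReal_nonneg _ _ _) (Finset.mem_univ c)
    _ = ∑ c : {b : Fin K // b ≠ a}, ∫ θ, f (θ c.1) ∂P :=
        integral_finsetSum _ fun c _ => hint c.1
    _ ≤ _ := by
        simp_rw [hval]
        rw [← hcard, ← nsmul_eq_mul, ← Finset.card_univ]
        exact Finset.sum_le_card_nsmul _ _ _ fun c _ =>
          le_ciSup (f := fun c : {b : Fin K // b ≠ a} =>
            (Real.sqrt (2 * Real.pi * ((σ a) ^ 2 + (σ c.1) ^ 2)))⁻¹ *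
              Real.exp (-(μ c.1 - μ a) ^ 2 / (2 * ((σ a) ^ 2 + (σ c.1) ^ 2))))
            (Set.finite_range _).bddAbove c
end
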